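/- arXiv:math/0406133 — 2 statements merged into one kernel-verified Lean document; each statement's English description precedes it below -/
import Mathlib

section
/- (Witt) Let k be a field of characteristic ≠ 2 and a, b ∈ k×. The Brauer kernel κ(k(C_{a,b})/k) of the conic function field equals {0, [ℍ(a,b)]}, the subgroup of Br(k) generated by the class of the quaternion algebra ℍ(a,b). In particular, κ(k(C_{a,b})/k) is trivial if and only if ℍ(a,b) is split (equivalently, if and only if the conic has a k-rational point). -/
open scoped TensorProduct
open Quaternion
set_option synthInstance.maxHeartbeats 1000000
set_option maxHeartbeats 1000000
noncomputable section

universe u v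

/-- Upper-triangular coefficient matrix of a quadratic form on `Fin n → R`. -/
def coeffMatrix {R : Type*} [CommRing R] {n : ℕ} (q : QuadraticForm R (Fin n → R)) :
    Matrix (Fin n) (Fin n) R :=
  Matrix.of fun i j =>
    if i = j then q (Pi.single i 1)
    else if i < j then QuadraticMap.polar q (Pi.single i 1) (Pi.single j 1)
    else 0

/-- Base change of a quadratic form on `Fin n → R` along `R → l`. -/
def extendQF {R : Type*} [CommRing R] {n : ℕ} (q : QuadraticForm R (Fin n → R))
    (l : Type*) [CommRing l] [Algebra R l] : QuadraticForm l (Fin n → l) :=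
  ((coeffMatrix q).map (algebraMap R l)).toQuadraticMap'

/-- Gram matrix of the polar bilinear form of `q`. -/
def polarMatrix {R : Type*} [CommRing R] {n : ℕ} (q : QuadraticForm R (Fin n → R)) :
    Matrix (Fin n) (Fin n) R :=
  Matrix.of fun i j => QuadraticMap.polar q (Pi.single i 1) (Pi.single j 1)

/-- Discriminant: determinant of the Gram matrix (well defined up to squares). -/
def discQF {R : Type*} [CommRing R] {n : ℕ} (q : QuadraticForm R (Fin n → R)) : R :=
  (polarMatrix q).det

/-- Nondegeneracy (char ≠ 2): the Gram determinant is nonzero. -/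
def NondegQF {R : Type*} [CommRing R] {n : ℕ} (q : QuadraticForm R (Fin n → R)) : Prop :=
  discQF q ≠ 0

/-- Two quadratic forms are similar if one is isometric to a unit scaling of the other. -/
def SimilarQF {R : Type*} [CommRing R] {n : ℕ} (q q' : QuadraticForm R (Fin n → R)) : Prop :=
  ∃ c : R, IsUnit c ∧ QuadraticMap.Equivalent (c • q) q'

/-- The polynomial `q(X₁, …, X_{n-1}, 1)` defining the affine quadric. -/
def affineQuadricPoly {R : Type*} [CommRing R] {n : ℕ} (q : QuadraticForm R (Fin n → R)) :
    MvPolynomial (Fin (n - 1)) R :=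
  (extendQF q (MvPolynomial (Fin (n - 1)) R))
    (fun i => if h : (i : ℕ) < n - 1 then MvPolynomial.X ⟨i, h⟩ else 1)

/-- Affine coordinate ring `R[x₁,…,x_{n-1}]/(q(x₁,…,x_{n-1},1))` of the quadric. -/
abbrev quadricCoordRing {R : Type*} [CommRing R] {n : ℕ}
    (q : QuadraticForm R (Fin n → R)) : Type _ :=
  MvPolynomial (Fin (n - 1)) R ⧸ Ideal.span {affineQuadricPoly q}

/-- Function field `k(q)` of the quadric hypersurface `q = 0`. -/
abbrev quadricFunctionField {R : Type*} [CommRing R] {n : ℕ}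
    (q : QuadraticForm R (Fin n → R)) : Type _ :=
  FractionRing (quadricCoordRing q)

/-- Affine coordinate ring `k[x,y]/(ax²+by²-1)` of the conic `C_{a,b}`. -/
abbrev conicCoordRing (k : Type*) [Field k] (a b : k) : Type _ :=
  MvPolynomial (Fin 2) k ⧸
    Ideal.span {(MvPolynomial.C a * MvPolynomial.X 0 ^ 2 +
      MvPolynomial.C b * MvPolynomial.X 1 ^ 2 - 1 : MvPolynomial (Fin 2) k)}

/-- The conic function field `k(C_{a,b})`. -/
abbrev conicFunctionField (k : Type*) [Field k] (a b : k) : Type _ :=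
  FractionRing (conicCoordRing k a b)

/-- A `k`-algebra is split if it is isomorphic to a matrix algebra over `k`. -/
def IsSplitAlg (k A : Type*) [Field k] [Ring A] [Algebra k A] : Prop :=
  ∃ n : ℕ, 0 < n ∧ Nonempty (A ≃ₐ[k] Matrix (Fin n) (Fin n) k)

/-- `A` is split by the extension `K/k`: the class of `A` lies in the Brauer kernel
`κ(K/k) = ker (Br k → Br K)`. -/
def SplitsIn (k : Type*) [Field k] (A : Type*) [Ring A] [Algebra k A]
    (K : Type*) [CommRing K] [Algebra k K] : Prop :=
  ∃ n : ℕ, 0 < n ∧ Nonempty ((K ⊗[k] A) ≃ₐ[K] Matrix (Fin n) (Fin n) K)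

/-- Brauer equivalence of two `k`-algebras. -/
def BrauerEquiv (k A B : Type*) [Field k] [Ring A] [Algebra k A] [Ring B] [Algebra k B] :
    Prop :=
  ∃ n m : ℕ, 0 < n ∧ 0 < m ∧
    Nonempty (Matrix (Fin n) (Fin n) A ≃ₐ[k] Matrix (Fin m) (Fin m) B)

/-- A field is finitely generated (over its prime subfield). -/
def FieldFG (K : Type*) [Field K] : Prop :=
  ∃ s : Finset K, Subfield.closure (s : Set K) = ⊤

/-- Elementary equivalence in the first-order language of rings. -/
def ElemEquivRing (K₁ : Type*) (K₂ : Type*) [CommRing K₁] [CommRing K₂] : Prop :=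
  letI := FirstOrder.Ring.compatibleRingOfRing K₁
  letI := FirstOrder.Ring.compatibleRingOfRing K₂
  FirstOrder.Language.ring.ElementarilyEquivalent K₁ K₂

/-- The `m`-fold Pfister form `⟨⟨a₁,…,aₘ⟩⟩ = ⟨1,a₁⟩ ⊗ ⋯ ⊗ ⟨1,aₘ⟩`. -/
def pfisterForm {k : Type*} [Field k] {m : ℕ} (a : Fin m → k) :
    QuadraticForm k (Fin (2 ^ m) → k) :=
  QuadraticMap.weightedSumSquares k
    (fun j : Fin (2 ^ m) => ∏ i : Fin m, if Nat.testBit (j : ℕ) (i : ℕ) then a i else 1)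

/-- A quaternion algebra with invertible parameters over a field of characteristic not two is
simple. -/
theorem isSimpleRing_quaternionAlgebra {k : Type*} [Field k] (h2 : (2 : k) ≠ 0) {a b : k}
    (ha : a ≠ 0) (hb : b ≠ 0) : IsSimpleRing ℍ[k,a,b] := by
  have key : ∀ I : Ideal ℍ[k,a,b], I.IsTwoSided → ∀ x ∈ I, x.re ≠ 0 → I = ⊤ := by
    intro I hI x hx h0
    let i : ℍ[k,a,b] := ⟨0, 1, 0, 0⟩
    let j : ℍ[k,a,b] := ⟨0, 0, 1, 0⟩
    let l : ℍ[k,a,b] := ⟨0, 0, 0, 1⟩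
    have hcomb : (x + a⁻¹ • (i * x * i) + b⁻¹ • (j * x * j) - (a * b)⁻¹ • (l * x * l) :
        ℍ[k,a,b]) = algebraMap k _ (2 * 2 * x.re) := by
      ext <;> simp [i, j, l, QuaternionAlgebra.algebraMap_eq] <;> field_simp <;> ring
    have hmem : algebraMap k ℍ[k,a,b] (2 * 2 * x.re) ∈ I := by
      rw [← hcomb]
      have hsm : ∀ (c : k) (y z : ℍ[k,a,b]), c • (y * x * z) ∈ I := fun c y z => by
        rw [Algebra.smul_def]
        exact I.mul_mem_left _ (I.mul_mem_right _ (I.mul_mem_left _ hx))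
      exact I.sub_mem (I.add_mem (I.add_mem hx (hsm _ _ _)) (hsm _ _ _)) (hsm _ _ _)
    exact Ideal.eq_top_of_isUnit_mem _ hmem
      ((IsUnit.mk0 _ (mul_ne_zero (mul_ne_zero h2 h2) h0)).map (algebraMap k ℍ[k,a,b]))
  rw [isSimpleRing_iff_isTwoSided_imp]
  refine ⟨inferInstance, fun I hI => ?_⟩
  by_contra! hne
  obtain ⟨x, hx, hx0⟩ := I.ne_bot_iff.1 hne.1
  have hre : ∀ y ∈ I, y.re = 0 := fun y hy => by
    by_contra h
    exact hne.2 (key I hI y hy h)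
  refine hx0 ?_
  have h1 := hre x hx
  have hi := hre _ (I.mul_mem_left (⟨0, 1, 0, 0⟩ : ℍ[k,a,b]) hx)
  have hj := hre _ (I.mul_mem_left (⟨0, 0, 1, 0⟩ : ℍ[k,a,b]) hx)
  have hl := hre _ (I.mul_mem_left (⟨0, 0, 0, 1⟩ : ℍ[k,a,b]) hx)
  simp only [QuaternionAlgebra.re_mul] at hi hj hl
  ext
  · simpa using h1
  · simpa [ha] using hi
  · simpa [hb] using hj
  · simpa [ha, hb] using hl

/-- A quaternion algebra whose first parameter is invertible over a field of characteristic not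
two is central. -/
theorem isCentral_quaternionAlgebra {k : Type*} [Field k] (h2 : (2 : k) ≠ 0) {a b : k}
    (ha : a ≠ 0) : Algebra.IsCentral k ℍ[k,a,b] := by
  refine ⟨fun x hx => ?_⟩
  rw [Subalgebra.mem_center_iff] at hx
  have h4 : ∀ c d : k, d ≠ 0 → d * c = -(d * c) → c = 0 := fun c d hd h => by
    have : 2 * (d * c) = 0 := by linear_combination h
    simpa [h2, hd] using this
  have hi := hx ⟨0, 1, 0, 0⟩
  have hj := hx ⟨0, 0, 1, 0⟩
  have hiJ := congrArg QuaternionAlgebra.imJ hi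
  have hiK := congrArg QuaternionAlgebra.imK hi
  have hjK := congrArg QuaternionAlgebra.imK hj
  simp at hiJ hiK hjK
  rw [Algebra.mem_bot]
  refine ⟨x.re, ?_⟩
  ext
  · simp
  · simpa using (h4 _ 1 one_ne_zero (by linear_combination -hjK)).symm
  · simpa using (h4 _ 1 one_ne_zero (by linear_combination hiK)).symm
  · simpa using (h4 _ a ha (by linear_combination hiJ)).symm

/-- A four-dimensional algebra containing anticommuting square roots of `a` and `b` is the
quaternion algebra `ℍ(a,b)`. -/
theorem quaternionAlgebra_algEquiv_of_basis {k : Type*} [Field k] (h2 : (2 : k) ≠ 0) {a b : k}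
    (ha : a ≠ 0) (hb : b ≠ 0) {E : Type*} [Ring E] [Algebra k E]
    (hE : Module.finrank k E = 4) (I J : E) (hI : I * I = algebraMap k E a)
    (hJ : J * J = algebraMap k E b) (hIJ : J * I = -(I * J)) :
    Nonempty (ℍ[k,a,b] ≃ₐ[k] E) := by
  have := isSimpleRing_quaternionAlgebra h2 ha hb
  have : Module.Finite k E := Module.finite_of_finrank_pos (by omega)
  have : Nontrivial E := Module.nontrivial_of_finrank_pos (R := k) (by omega)
  let B : QuaternionAlgebra.Basis E a 0 b :=
    { i := I
      j := J
      k := I * J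
      i_mul_i := by rw [hI, Algebra.algebraMap_eq_smul_one]; simp
      j_mul_j := by rw [hJ, Algebra.algebraMap_eq_smul_one]
      i_mul_j := rfl
      j_mul_i := by rw [hIJ]; simp }
  have hinj : Function.Injective B.liftHom := B.liftHom.toRingHom.injective
  have hsurj : Function.Surjective B.liftHom :=
    (LinearMap.injective_iff_surjective_of_finrank_eq_finrank (f := B.liftHom.toLinearMap)
      (by rw [hE, QuaternionAlgebra.finrank_eq_four])).1 hinj
  exact ⟨AlgEquiv.ofBijective B.liftHom ⟨hinj, hsurj⟩⟩

/-- If the conic `a x² + b y² = z²` has a rational point, then `b` is a norm from `k(√a)`. -/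
theorem exists_eq_sq_sub_of_conic_point {k : Type*} [Field k] (h2 : (2 : k) ≠ 0) {a b : k}
    (ha : a ≠ 0) {x y z : k} (h0 : ¬(x = 0 ∧ y = 0 ∧ z = 0))
    (h : a * x ^ 2 + b * y ^ 2 = z ^ 2) : ∃ u v : k, b = u ^ 2 - a * v ^ 2 := by
  by_cases hy : y = 0
  · have hx : x ≠ 0 := by
      rintro rfl
      refine h0 ⟨rfl, hy, ?_⟩
      simpa [hy] using h.symm
    have hz : z ≠ 0 := by
      rintro rfl
      simp [hy, ha, hx] at h
    refine ⟨(b + 1) / 2, (b - 1) * x / (2 * z), ?_⟩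
    subst hy
    have h' : a * x ^ 2 = z ^ 2 := by simpa using h
    field_simp
    linear_combination (b - 1) ^ 2 * h'
  · refine ⟨z / y, x / y, ?_⟩
    field_simp
    linear_combination h

/-- Matrices realising `ℍ(a,b)` when `b = u² - a v²`. -/
theorem exists_matrix_quaternion_basis {k : Type*} [CommRing k] {a b u v : k}
    (h : b = u ^ 2 - a * v ^ 2) :
    ∃ I J : Matrix (Fin 2) (Fin 2) k, I * I = algebraMap k _ a ∧ J * J = algebraMap k _ b ∧
      J * I = -(I * J) := by
  refine ⟨!![0, a; 1, 0], !![u, -(a * v); v, -u], ?_, ?_, ?_⟩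
  · ext i j
    fin_cases i <;> fin_cases j <;> simp [Matrix.algebraMap_matrix_apply]
  · ext i j
    fin_cases i <;> fin_cases j <;> simp [Matrix.algebraMap_matrix_apply, h] <;> ring
  · ext i j
    fin_cases i <;> fin_cases j <;> simp [mul_comm]

theorem quaternionAlgebra_algEquiv_matrix {k : Type*} [Field k] (h2 : (2 : k) ≠ 0) {a b : k}
    (ha : a ≠ 0) (hb : b ≠ 0) {x y z : k} (h0 : ¬(x = 0 ∧ y = 0 ∧ z = 0))
    (h : a * x ^ 2 + b * y ^ 2 = z ^ 2) :
    Nonempty (ℍ[k,a,b] ≃ₐ[k] Matrix (Fin 2) (Fin 2) k) := by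
  obtain ⟨u, v, huv⟩ := exists_eq_sq_sub_of_conic_point h2 ha h0 h
  obtain ⟨I, J, hI, hJ, hIJ⟩ := exists_matrix_quaternion_basis huv
  exact quaternionAlgebra_algEquiv_of_basis h2 ha hb (by simp [Module.finrank_matrix]) I J hI hJ hIJ

/-- The quaternion algebra `ℍ(a,b)` is split iff the conic `a x² + b y² = z²` has a rational
point. -/
theorem isSplitAlg_quaternionAlgebra_iff {k : Type*} [Field k] (h2 : (2 : k) ≠ 0) {a b : k}
    (ha : a ≠ 0) (hb : b ≠ 0) : IsSplitAlg k ℍ[k,a,b] ↔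
      ∃ x y z : k, ¬(x = 0 ∧ y = 0 ∧ z = 0) ∧ a * x ^ 2 + b * y ^ 2 = z ^ 2 := by
  constructor
  · rintro ⟨n, -, ⟨e⟩⟩
    have hn : n * n = 4 := by
      have := e.toLinearEquiv.finrank_eq
      rw [QuaternionAlgebra.finrank_eq_four] at this
      simpa [Module.finrank_matrix] using this.symm
    obtain rfl : n = 2 := by nlinarith
    let q := e.symm !![0, 1; 0, 0]
    have hq0 : q ≠ 0 := by
      intro h
      have := congrFun (congrFun ((map_eq_zero_iff _ e.symm.injective).1 h) 0) 1
      simp at this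
    have hqq : q * q = 0 := by
      rw [← map_mul, map_eq_zero_iff _ e.symm.injective]
      ext i j
      fin_cases i <;> fin_cases j <;> simp
    have h1 := congrArg QuaternionAlgebra.re hqq
    have hI := congrArg QuaternionAlgebra.imI hqq
    have hJ := congrArg QuaternionAlgebra.imJ hqq
    have hK := congrArg QuaternionAlgebra.imK hqq
    simp only [QuaternionAlgebra.re_mul, QuaternionAlgebra.imI_mul, QuaternionAlgebra.imJ_mul,
      QuaternionAlgebra.imK_mul, QuaternionAlgebra.re_zero, QuaternionAlgebra.imI_zero,
      QuaternionAlgebra.imJ_zero, QuaternionAlgebra.imK_zero] at h1 hI hJ hK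
    have hre : q.re = 0 := by
      by_contra hr
      have hc : ∀ c : k, 2 * q.re * c = 0 → c = 0 := fun c h => by simpa [h2, hr] using h
      have eI := hc q.imI (by linear_combination hI)
      have eJ := hc q.imJ (by linear_combination hJ)
      have eK := hc q.imK (by linear_combination hK)
      rw [eI, eJ, eK] at h1
      exact hr (by simpa using h1)
    refine ⟨q.imJ / a, q.imI / b, q.imK, ?_, ?_⟩
    · rintro ⟨hj, hi, hk⟩
      refine hq0 (QuaternionAlgebra.ext hre ?_ ?_ hk)
      · simpa [hb] using hi
      · simpa [ha] using hj
    · field_simp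
      rw [hre] at h1
      linear_combination h1
  · rintro ⟨x, y, z, h0, h⟩
    exact ⟨2, two_pos, quaternionAlgebra_algEquiv_matrix h2 ha hb h0 h⟩

/-- If a full matrix algebra over `B` is split, then so is `B`. -/
theorem isSplitAlg_of_matrix {K : Type*} [Field K] {B : Type*} [Ring B] [Algebra K B] {q N : ℕ}
    (hq : 0 < q) (hN : 0 < N)
    (e : Matrix (Fin q) (Fin q) B ≃ₐ[K] Matrix (Fin N) (Fin N) K) : IsSplitAlg K B := by
  have : NeZero q := ⟨hq.ne'⟩
  have : NeZero N := ⟨hN.ne'⟩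
  let ψ : Matrix (Fin q) (Fin q) B ≃ₐ[K] Module.End K (Fin N → K) :=
    e.trans Matrix.toLinAlgEquiv'
  let ε : B → Matrix (Fin q) (Fin q) B := Matrix.single 0 0
  have hεmul : ∀ b c, ε b * ε c = ε (b * c) := fun b c => by simp [ε]
  have hψ : ∀ M M' v, ψ (M * M') v = ψ M (ψ M' v) := fun M M' v => by rw [map_mul]; rfl
  let W : Submodule K (Fin N → K) := LinearMap.range (ψ (ε 1))
  have hW : ∀ w ∈ W, ψ (ε 1) w = w := by
    rintro _ ⟨v, rfl⟩
    rw [← hψ, hεmul, one_mul]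
  have hmem : ∀ b v, ψ (ε b) v ∈ W := fun b v => ⟨ψ (ε b) v, by rw [← hψ, hεmul, one_mul]⟩
  let ρ : B →ₐ[K] Module.End K W := AlgHom.ofLinearMap
    { toFun := fun b => (ψ (ε b)).restrict (fun v _ => hmem b v)
      map_add' := fun b c => by
        ext1 w
        exact Subtype.ext (by simp [ε, Matrix.single_add])
      map_smul' := fun r c => by
        ext1 w
        exact Subtype.ext (by
          have : ε (r • c) = r • ε c := by simp [ε, Matrix.smul_single]
          simp [this]) }
    (by
      ext1 w
      exact Subtype.ext (hW w w.2))
    (fun b c => by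
      ext1 w
      exact Subtype.ext (by
        change ψ (ε (b * c)) w = ψ (ε b) (ψ (ε c) w)
        rw [← hψ, hεmul]))
  have hρ : ∀ b w, ((ρ b w : W) : Fin N → K) = ψ (ε b) w := fun _ _ => rfl
  have hinj : Function.Injective ρ := by
    rw [injective_iff_map_eq_zero]
    intro b hb
    have h1 : ψ (ε b) = 0 := by
      refine LinearMap.ext fun v => ?_
      have := congrArg Subtype.val (LinearMap.congr_fun hb ⟨ψ (ε 1) v, hmem 1 v⟩)
      rw [hρ, ← hψ, hεmul, mul_one] at this
      simpa using this
    have h2 := congrFun (congrFun ((map_eq_zero_iff _ ψ.injective).1 h1) 0) 0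
    simpa [ε] using h2
  have hsurj : Function.Surjective ρ := by
    intro T
    obtain ⟨M, hM⟩ := ψ.surjective
      (W.subtype ∘ₗ T ∘ₗ (ψ (ε 1)).codRestrict W (fun v => hmem 1 v))
    have hMM : ε 1 * M * ε 1 = M := by
      apply ψ.injective
      refine LinearMap.ext fun v => ?_
      rw [hψ, hψ, hM]
      simp only [LinearMap.comp_apply, Submodule.subtype_apply]
      rw [hW _ (Subtype.prop _)]
      congr 2
      exact Subtype.ext (by simp [hW _ (hmem 1 v)])
    have hM0 : M = ε (M 0 0) := by
      conv_lhs => rw [← hMM]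
      simp [ε]
    refine ⟨M 0 0, ?_⟩
    ext1 w
    apply Subtype.ext
    rw [hρ, ← hM0, hM]
    simp only [LinearMap.comp_apply, Submodule.subtype_apply]
    congr 2
    exact Subtype.ext (hW w w.2)
  have : Nontrivial B := by
    by_contra h
    rw [not_nontrivial_iff_subsingleton] at h
    have := e.symm.injective.subsingleton
    exact not_subsingleton (Matrix (Fin N) (Fin N) K) this
  have hWn : Nontrivial W := by
    by_contra h
    rw [not_nontrivial_iff_subsingleton] at h
    exact not_subsingleton B hinj.subsingleton
  exact ⟨Module.finrank K W, Module.finrank_pos,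
    ⟨(AlgEquiv.ofBijective ρ ⟨hinj, hsurj⟩).trans (algEquivMatrix (Module.finBasis K W))⟩⟩

/-- Base change commutes with the formation of matrix algebras. -/
def baseChangeMatrix (k K A ι : Type*) [Field k] [Field K] [Algebra k K] [Ring A] [Algebra k A]
    [Fintype ι] [DecidableEq ι] :
    K ⊗[k] Matrix ι ι A ≃ₐ[K] Matrix ι ι (K ⊗[k] A) :=
  ((Algebra.TensorProduct.congr (Matrix.uniqueAlgEquiv (m := Unit) (R := K)).symm
    AlgEquiv.refl).trans (Matrix.kroneckerTMulAlgEquiv Unit ι k K K A)).trans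
      (Matrix.reindexAlgEquiv K _ (Equiv.punitProd ι))

/-- Matrices over a matrix algebra form a matrix algebra. -/
def matrixMatrixFin (K R : Type*) [Field K] [Ring R] [Algebra K R] (m n : ℕ) :
    Matrix (Fin m) (Fin m) (Matrix (Fin n) (Fin n) R) ≃ₐ[K] Matrix (Fin (m * n)) (Fin (m * n)) R :=
  (Matrix.compAlgEquiv (Fin m) (Fin n) R K).trans (Matrix.reindexAlgEquiv K _ finProdFinEquiv)

/-- An algebra Brauer equivalent to a split one is split. -/
theorem isSplitAlg_of_brauerEquiv {k A B : Type*} [Field k] [Ring A] [Algebra k A] [Ring B]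
    [Algebra k B] (hAB : BrauerEquiv k A B) (hB : IsSplitAlg k B) : IsSplitAlg k A := by
  obtain ⟨n, m, hn, hm, ⟨e⟩⟩ := hAB
  obtain ⟨r, hr, ⟨f⟩⟩ := hB
  exact isSplitAlg_of_matrix hn (Nat.mul_pos hm hr)
    ((e.trans f.mapMatrix).trans (matrixMatrixFin k k m r))

/-- Brauer equivalence is preserved by base change. -/
theorem BrauerEquiv.baseChange {k A B : Type*} [Field k] [Ring A] [Algebra k A] [Ring B]
    [Algebra k B] (hAB : BrauerEquiv k A B) (K : Type*) [Field K] [Algebra k K] :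
    BrauerEquiv K (K ⊗[k] A) (K ⊗[k] B) := by
  obtain ⟨n, m, hn, hm, ⟨e⟩⟩ := hAB
  exact ⟨n, m, hn, hm, ⟨((baseChangeMatrix k K A (Fin n)).symm.trans
    (Algebra.TensorProduct.congr AlgEquiv.refl e)).trans (baseChangeMatrix k K B (Fin m))⟩⟩

/-- A split algebra is split by every extension. -/
theorem IsSplitAlg.splitsIn {k A : Type*} [Field k] [Ring A] [Algebra k A] (hA : IsSplitAlg k A)
    (K : Type*) [Field K] [Algebra k K] : SplitsIn k A K := by
  obtain ⟨n, hn, ⟨e⟩⟩ := hA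
  exact ⟨n, hn, ⟨((Algebra.TensorProduct.congr AlgEquiv.refl e).trans
    (baseChangeMatrix k K k (Fin n))).trans (Algebra.TensorProduct.rid k K K).mapMatrix⟩⟩

/-- `ℍ(a,b)` is split by any extension over which the conic acquires a point. -/
theorem splitsIn_quaternionAlgebra {k : Type*} [Field k] (h2 : (2 : k) ≠ 0) {a b : k}
    (ha : a ≠ 0) (hb : b ≠ 0) {K : Type*} [Field K] [Algebra k K] {s t : K}
    (hst : algebraMap k K a * t ^ 2 + algebraMap k K b * s ^ 2 = 1) :
    SplitsIn k ℍ[k,a,b] K := by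
  have h2' : (2 : K) ≠ 0 := by
    rw [← map_ofNat (algebraMap k K) 2]
    exact (map_ne_zero _).2 h2
  have ha' : algebraMap k K a ≠ 0 := (map_ne_zero _).2 ha
  have hb' : algebraMap k K b ≠ 0 := (map_ne_zero _).2 hb
  have hfin : Module.finrank K (K ⊗[k] ℍ[k,a,b]) = 4 := by
    rw [Module.finrank_baseChange, QuaternionAlgebra.finrank_eq_four]
  let ι : ℍ[k,a,b] →ₐ[k] K ⊗[k] ℍ[k,a,b] := Algebra.TensorProduct.includeRight
  have hι : ∀ c, ι (algebraMap k _ c) = algebraMap K _ (algebraMap k K c) := fun c => by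
    rw [AlgHom.commutes, ← IsScalarTower.algebraMap_apply]
  obtain ⟨e⟩ := quaternionAlgebra_algEquiv_of_basis h2' ha' hb' hfin
    (ι ⟨0, 1, 0, 0⟩) (ι ⟨0, 0, 1, 0⟩)
    (by rw [← map_mul, ← hι]; congr 1; ext <;> simp)
    (by rw [← map_mul, ← hι]; congr 1; ext <;> simp)
    (by rw [← map_mul, ← map_mul, ← map_neg]; congr 1; ext <;> simp)
  obtain ⟨f⟩ := quaternionAlgebra_algEquiv_matrix h2' ha' hb' (x := t) (y := s) (z := 1)
    (by simp) (by simpa using hst)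
  exact ⟨2, two_pos, ⟨e.symm.trans f⟩⟩

section PolynomialDivisionAlgebra

open Polynomial

variable {k D : Type*} [Field k] [DivisionRing D] [Algebra k D]

theorem map_algebraMap_mul_comm (h : k[X]) (p : D[X]) :
    h.map (algebraMap k D) * p = p * h.map (algebraMap k D) := by
  let := Polynomial.algebra k D
  exact Algebra.commutes (A := D[X]) h p

/-- Every nonzero polynomial over a finite-dimensional division algebra has a nonzero central left
multiple. -/
theorem exists_mul_eq_map_algebraMap [Module.Finite k D] {p : D[X]} (hp : p ≠ 0) :
    ∃ (q : D[X]) (h : k[X]), h ≠ 0 ∧ q * p = h.map (algebraMap k D) := by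
  classical
  let := Polynomial.algebra k D
  have hsmul : ∀ (f : k[X]) (g : D[X]), f • g = f.map (algebraMap k D) * g := fun f g =>
    Algebra.smul_def f g
  have hfin : Module.Finite k[X] D[X] := by
    let e := Module.finBasis k D
    refine ⟨⟨Finset.univ.image fun i => C (e i), ?_⟩⟩
    rw [eq_top_iff]
    rintro f -
    induction f using Polynomial.induction_on' with
    | add f g hf hg => exact add_mem hf hg
    | monomial n d =>
      rw [← e.sum_repr d, map_sum]
      refine sum_mem fun i _ => ?_
      have : monomial n (e.repr d i • e i) = (monomial n (e.repr d i) : k[X]) • C (e i) := by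
        rw [hsmul, map_monomial, monomial_mul_C, Algebra.smul_def]
      rw [this]
      exact Submodule.smul_mem _ _ (Submodule.subset_span (by simp))
  have halg : IsAlgebraic k[X] p := (IsIntegral.of_finite k[X] p).isAlgebraic
  obtain ⟨h, hh, q, hq⟩ := halg.exists_nonzero_dvd (mem_nonZeroDivisors_of_ne_zero hp)
  refine ⟨q, h, hh, mul_left_cancel₀ hp ?_⟩
  rw [← mul_assoc, ← hq, Polynomial.algebraMap_def, coe_mapRingHom, map_algebraMap_mul_comm]

/-- Two polynomials over a division ring, one of them nonzero, have a greatest common left divisor,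
which is a right linear combination of the two. -/
theorem exists_left_gcd (h p : D[X]) (hh : h ≠ 0) :
    ∃ w h' p' u v : D[X], w ≠ 0 ∧ h = w * h' ∧ p = w * p' ∧ w = h * u + p * v := by
  classical
  let S : Set ℕ := {n | ∃ u v : D[X], h * u + p * v ≠ 0 ∧ (h * u + p * v).natDegree = n}
  have hS : S.Nonempty := ⟨_, 1, 0, by simpa using hh, rfl⟩
  obtain ⟨u, v, hw0, hdeg⟩ := Nat.sInf_mem hS
  set w₀ := h * u + p * v with hw₀
  have hl : w₀.leadingCoeff ≠ 0 := leadingCoeff_ne_zero.2 hw0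
  set c : D := w₀.leadingCoeff⁻¹ with hc
  have hc0 : c ≠ 0 := inv_ne_zero hl
  set w := w₀ * C c with hw
  have hmonic : w.Monic := monic_mul_C_of_leadingCoeff_mul_eq_one (mul_inv_cancel₀ hl)
  have hwdeg : w.natDegree = sInf S := by
    rw [hw, natDegree_mul_C hc0, hdeg]
  have hwuv : w = h * (u * C c) + p * (v * C c) := by
    rw [hw, hw₀, add_mul, mul_assoc, mul_assoc]
  have hmod : ∀ f : D[X], (∃ x y, f = h * x + p * y) → f = w * (f /ₘ w) := by
    rintro f ⟨x, y, hf⟩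
    have hdiv := modByMonic_add_div f w
    have hr : f %ₘ w = 0 := by
      by_contra hr0
      have hlt : (f %ₘ w).natDegree < w.natDegree :=
        natDegree_lt_natDegree hr0 (degree_modByMonic_lt f hmonic)
      rw [hwdeg] at hlt
      refine Nat.notMem_of_lt_sInf hlt
        ⟨x - u * C c * (f /ₘ w), y - v * C c * (f /ₘ w), ?_⟩
      have : h * (x - u * C c * (f /ₘ w)) + p * (y - v * C c * (f /ₘ w)) = f %ₘ w := by
        rw [eq_sub_of_add_eq hdiv]
        nth_rewrite 3 [hf]
        nth_rewrite 3 [hwuv]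
        noncomm_ring
      rw [this]
      exact ⟨hr0, rfl⟩
    rw [hr, zero_add] at hdiv
    exact hdiv.symm
  exact ⟨w, _, _, _, _, hmonic.ne_zero, hmod h ⟨1, 0, by simp⟩, hmod p ⟨0, 1, by simp⟩, hwuv⟩

/-- A central polynomial which is a square in the ring of fractions of `D[X]` is already a square in
`D[X]`. -/
theorem exists_mul_self_eq_map {h c : k[X]} (hh : h ≠ 0) {p : D[X]}
    (hp : p * p = (h * h * c).map (algebraMap k D)) :
    ∃ g : D[X], g * g = c.map (algebraMap k D) := by
  set H := h.map (algebraMap k D) with hH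
  set c' := c.map (algebraMap k D) with hc'
  have hH0 : H ≠ 0 := (Polynomial.map_ne_zero_iff (algebraMap k D).injective).2 hh
  have hcH : ∀ f, H * f = f * H := map_algebraMap_mul_comm h
  have hcc : ∀ f, c' * f = f * c' := map_algebraMap_mul_comm c
  rw [Polynomial.map_mul, Polynomial.map_mul, ← hH, ← hc'] at hp
  obtain ⟨w, h', p', u, v, hw, hwh, hwp, hwuv⟩ := exists_left_gcd H p hH0
  set g := p' * u + h' * c' * v with hg
  have hpw : p * w = H * (w * g) := by
    calc p * w = p * H * u + p * p * v := by nth_rewrite 1 [hwuv]; noncomm_ring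
      _ = H * (p * u + H * c' * v) := by
        rw [hp, ← hcH, mul_add]
        simp only [mul_assoc]
      _ = H * (w * g) := by
        rw [hg]
        nth_rewrite 1 [hwp]
        nth_rewrite 2 [hwh]
        noncomm_ring
  refine ⟨g, mul_left_cancel₀ hw (mul_left_cancel₀ hH0 (mul_left_cancel₀ hH0 ?_))⟩
  calc H * (H * (w * (g * g))) = H * (H * (w * g) * g) := by noncomm_ring
    _ = H * (p * w * g) := by rw [hpw]
    _ = p * (H * (w * g)) := by rw [mul_assoc p, ← mul_assoc, hcH, mul_assoc]
    _ = p * p * w := by rw [← hpw, mul_assoc]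
    _ = H * (H * (w * c')) := by rw [hp, ← hcc w]; noncomm_ring

/-- A square root of `a - a b X²` in `D[X]` yields anticommuting square roots of `a` and `b`
in `D`. -/
theorem exists_quaternion_basis_of_mul_self_eq {a b : k} (ha : a ≠ 0) {g : D[X]}
    (hg : g * g = (C a - C (a * b) * X ^ 2 : k[X]).map (algebraMap k D)) :
    ∃ I J : D, I * I = algebraMap k D a ∧ J * J = algebraMap k D b ∧ J * I = -(I * J) := by
  set φ := algebraMap k D with hφ
  have hdeg : g.natDegree ≤ 1 := by
    have h1 : (g * g).natDegree ≤ 2 := by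
      rw [hg]
      refine (natDegree_map_le).trans ?_
      compute_degree
    by_cases hg0 : g = 0
    · simp [hg0]
    · rw [natDegree_mul hg0 hg0] at h1
      omega
  obtain ⟨β, α, rfl⟩ := exists_eq_X_add_C_of_natDegree_le_one hdeg
  have hexp : (C β * X + C α) * (C β * X + C α) =
      C (β * β) * X ^ 2 + C (β * α + α * β) * X + C (α * α) := by
    have hX : ∀ f : D[X], X * f = f * X := fun f => X_mul
    simp only [C_add, C_mul, add_mul, mul_add]
    rw [show C β * X * (C β * X) = C β * (X * C β) * X by noncomm_ring,
      show C β * X * C α = C β * (X * C α) by noncomm_ring, hX, hX]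
    noncomm_ring
  have hmap : (C a - C (a * b) * X ^ 2 : k[X]).map φ = C (φ a) - C (φ a * φ b) * X ^ 2 := by simp
  rw [hexp, hmap] at hg
  have h0 := congrArg (fun f => coeff f 0) hg
  have h1 := congrArg (fun f => coeff f 1) hg
  have h2 := congrArg (fun f => coeff f 2) hg
  simp [coeff_X, coeff_C, coeff_X_pow, -map_mul] at h0 h1 h2
  have hcomm : ∀ x : D, φ a * x = x * φ a := Algebra.commutes a
  have hφa : φ a ≠ 0 := (_root_.map_ne_zero _).2 ha
  have hβα : β * α = -(α * β) := eq_neg_of_add_eq_zero_left h1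
  have hinv : ∀ x : D, (φ a)⁻¹ * x = x * (φ a)⁻¹ := fun x =>
    (Commute.inv_left₀ (hcomm x)).eq
  refine ⟨α, (φ a)⁻¹ * (α * β), h0, ?_, ?_⟩
  · calc (φ a)⁻¹ * (α * β) * ((φ a)⁻¹ * (α * β))
        = (φ a)⁻¹ * (φ a)⁻¹ * (α * (β * α) * β) := by
          rw [mul_assoc, ← mul_assoc (α * β), ← hinv]
          noncomm_ring
      _ = (φ a)⁻¹ * (φ a)⁻¹ * -(α * α * (β * β)) := by rw [hβα]; noncomm_ring
      _ = φ b := by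
          rw [h0, h2, mul_neg, mul_neg, mul_neg, neg_neg, mul_assoc, inv_mul_cancel_left₀ hφa,
            inv_mul_cancel_left₀ hφa]
  · rw [mul_assoc, mul_assoc, hβα, ← mul_assoc α (φ a)⁻¹, ← hinv]
    noncomm_ring

end PolynomialDivisionAlgebra

section FunctionField

open Polynomial

variable {k K : Type*} [Field k] [Field K] [Algebra k K]

/-- The function field `k(s,t)` of the conic has degree at most two over `k(s)`. -/
theorem finrank_adjoin_simple_le_two {a b : k} (ha : a ≠ 0) {s t : K}
    (hst : algebraMap k K a * t ^ 2 + algebraMap k K b * s ^ 2 = 1)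
    (htop : IntermediateField.adjoin k {s, t} = ⊤) :
    Module.Finite (IntermediateField.adjoin k {s}) K ∧
      Module.finrank (IntermediateField.adjoin k {s}) K ≤ 2 := by
  set F := IntermediateField.adjoin k {s} with hF
  let s' : F := ⟨s, IntermediateField.mem_adjoin_simple_self k s⟩
  let d : F := algebraMap k F a⁻¹ * (1 - algebraMap k F b * s' ^ 2)
  have hroot : aeval t (X ^ 2 - C d : F[X]) = 0 := by
    have hd : algebraMap F K d = algebraMap k K a⁻¹ * (1 - algebraMap k K b * s ^ 2) := rfl
    have ha' : algebraMap k K a ≠ 0 := (_root_.map_ne_zero _).2 ha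
    rw [map_sub, map_pow, aeval_X, aeval_C, hd, ← hst, map_inv₀]
    field_simp
    ring
  have hmonic : (X ^ 2 - C d : F[X]).Monic := monic_X_pow_sub_C d two_ne_zero
  have hint : IsIntegral F t := ⟨_, hmonic, hroot⟩
  have hFt : IntermediateField.adjoin F {t} = ⊤ := by
    rw [← IntermediateField.restrictScalars_eq_top_iff (K := k),
      IntermediateField.adjoin_simple_adjoin_simple, htop]
  have hdeg : (minpoly F t).natDegree ≤ 2 := by
    have := natDegree_le_of_dvd (minpoly.dvd F t hroot) hmonic.ne_zero
    rwa [natDegree_X_pow_sub_C] at this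
  have hfin := IntermediateField.adjoin.finiteDimensional hint
  have hrank := IntermediateField.adjoin.finrank hint
  rw [hFt] at hfin hrank
  rw [IntermediateField.finrank_top'] at hrank
  exact ⟨Module.Finite.equiv (IntermediateField.topEquiv (F := F) (E := K)).toLinearEquiv,
    hrank ▸ hdeg⟩

/-- More than `2 n` vectors in `K ^ n` satisfy a nontrivial linear relation over `k[s]`. -/
theorem exists_polynomial_relation {a b : k} (ha : a ≠ 0) {s t : K}
    (hst : algebraMap k K a * t ^ 2 + algebraMap k K b * s ^ 2 = 1)
    (htop : IntermediateField.adjoin k {s, t} = ⊤) {n : ℕ} {ι : Type*} [Fintype ι]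
    (v : ι → Fin n → K) (hcard : 2 * n < Fintype.card ι) :
    ∃ h : ι → k[X], (∃ i, h i ≠ 0) ∧ ∑ i, aeval s (h i) • v i = 0 := by
  classical
  obtain ⟨hfin, hle⟩ := finrank_adjoin_simple_le_two ha hst htop
  set F := IntermediateField.adjoin k {s} with hF
  have hdep : ¬ LinearIndependent F v := fun hv => by
    have h1 := hv.fintype_card_le_finrank
    rw [Module.finrank_pi_fintype, Finset.sum_const, Finset.card_univ, Fintype.card_fin,
      smul_eq_mul] at h1
    nlinarith
  obtain ⟨c, hc, i₀, hi₀⟩ := Fintype.not_linearIndependent_iff.1 hdep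
  choose r q hrq using fun i => (IntermediateField.mem_adjoin_simple_iff k _).1 (c i).2
  have hrq' : ∀ i, ∃ r q : k[X], aeval s q ≠ 0 ∧ ((c i : F) : K) = aeval s r / aeval s q := by
    intro i
    by_cases hq : aeval s (q i) = 0
    · exact ⟨0, 1, by simp, by rw [hrq i, hq]; simp⟩
    · exact ⟨r i, q i, hq, hrq i⟩
  choose r q hq hrq using hrq'
  refine ⟨fun i => r i * ∏ j ∈ Finset.univ.erase i, q j, ⟨i₀, ?_⟩, ?_⟩
  · refine mul_ne_zero ?_ (Finset.prod_ne_zero_iff.2 fun j _ h => hq j (by rw [h, map_zero]))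
    rintro h
    apply hi₀
    apply Subtype.ext
    rw [hrq i₀, h]
    simp
  · have hterm : ∀ i, aeval s (r i * ∏ j ∈ Finset.univ.erase i, q j) • v i =
        (∏ j, aeval s (q j)) • (c i • v i) := by
      intro i
      rw [← Finset.mul_prod_erase _ _ (Finset.mem_univ i), IntermediateField.smul_def, smul_smul,
        hrq i, map_mul, map_prod]
      congr 1
      have := hq i
      field_simp
    simp_rw [hterm]
    rw [← Finset.smul_sum, hc, smul_zero]

/-- **Witt**: a division algebra split by the function field of a conic is either trivial or the
quaternion algebra of the conic. -/
theorem finrank_eq_one_or_algEquiv_quaternionAlgebra (h2 : (2 : k) ≠ 0) {a b : k} (ha : a ≠ 0)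
    (hb : b ≠ 0) {s t : K}
    (hst : algebraMap k K a * t ^ 2 + algebraMap k K b * s ^ 2 = 1)
    (htop : IntermediateField.adjoin k {s, t} = ⊤) (hs : Transcendental k s)
    {D : Type*} [DivisionRing D] [Algebra k D] [Module.Finite k D] (hD : SplitsIn k D K) :
    Module.finrank k D = 1 ∨ Nonempty (D ≃ₐ[k] ℍ[k,a,b]) := by
  obtain ⟨n, hn, ⟨e⟩⟩ := hD
  have : NeZero n := ⟨hn.ne'⟩
  have hrank : Module.finrank k D = n * n := by
    have := e.toLinearEquiv.finrank_eq
    rwa [Module.finrank_baseChange, Module.finrank_matrix, Fintype.card_fin, Module.finrank_self,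
      mul_one] at this
  let ε : D →ₐ[k] Matrix (Fin n) (Fin n) K :=
    (e.toAlgHom.restrictScalars k).comp Algebra.TensorProduct.includeRight
  let Φ : D[X] →+* Matrix (Fin n) (Fin n) K :=
    eval₂RingHom' ε.toRingHom (algebraMap K _ s) fun d => (Algebra.commutes s (ε d)).symm
  have hΦC : ∀ d, Φ (C d) = ε d := fun d => eval₂_C _ _
  have hΦmap : ∀ h : k[X], Φ (h.map (algebraMap k D)) = algebraMap K _ (aeval s h) := by
    intro h
    change eval₂ _ _ _ = _
    rw [eval₂_map, aeval_def, hom_eval₂]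
    congr 1
    ext1 c
    exact (ε.commutes c).trans (IsScalarTower.algebraMap_apply k K _ c)
  let w : Fin n → K := Pi.single 0 1
  have hw : w ≠ 0 := by simp [w]
  have htf : ∀ p : D[X], (Φ p).mulVec w = 0 → p = 0 := by
    intro p hp
    by_contra hp0
    obtain ⟨q, h, hh, hqp⟩ := exists_mul_eq_map_algebraMap (k := k) hp0
    have h1 : (Φ (q * p)).mulVec w = 0 := by
      rw [map_mul, ← Matrix.mulVec_mulVec, hp, Matrix.mulVec_zero]
    rw [hqp, hΦmap, Algebra.algebraMap_eq_smul_one, Matrix.smul_mulVec, Matrix.one_mulVec] at h1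
    rcases smul_eq_zero.1 h1 with h1 | h1
    · exact hh ((transcendental_iff.1 hs) h h1)
    · exact hw h1
  let β := Module.finBasis k D
  let comb : (Fin (Module.finrank k D) → k[X]) → D[X] :=
    fun h => ∑ i, (h i).map (algebraMap k D) * C (β i)
  have hcomb : ∀ h, (Φ (comb h)).mulVec w = ∑ i, aeval s (h i) • (ε (β i)).mulVec w := by
    intro h
    simp only [comb, map_sum, Matrix.sum_mulVec, map_mul, hΦmap, hΦC,
      Algebra.algebraMap_eq_smul_one, smul_mul_assoc, one_mul, Matrix.smul_mulVec]
  have hcomb0 : ∀ h, comb h = 0 → ∀ i, h i = 0 := by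
    intro h h0 i
    ext m
    have h1 : ∑ i, (h i).coeff m • β i = 0 := by
      have := congrArg (fun f => coeff f m) h0
      simpa [comb, finsetSum_coeff, Algebra.smul_def] using this
    simpa using Fintype.linearIndependent_iff.1 β.linearIndependent _ h1 i
  have hn2 : n ≤ 2 := by
    by_contra! hlt
    obtain ⟨h, ⟨i, hi⟩, hsum⟩ := exists_polynomial_relation ha hst htop
      (fun i => (ε (β i)).mulVec w) (by rw [Fintype.card_fin, hrank]; nlinarith)
    exact hi (hcomb0 h (htf _ ((hcomb h).trans hsum)) i)
  obtain rfl | rfl : n = 1 ∨ n = 2 := by omega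
  · exact Or.inl hrank
  right
  let y : K := algebraMap k K a * t
  have hy : y * y = aeval s (C a - C (a * b) * X ^ 2 : k[X]) := by
    simp only [y, map_sub, aeval_C, map_mul, map_pow, aeval_X]
    linear_combination algebraMap k K a * hst
  obtain ⟨h, ⟨i, hi⟩, hsum⟩ := exists_polynomial_relation ha hst htop
    (fun o : Option (Fin (Module.finrank k D)) => o.elim (y • w) fun i => (ε (β i)).mulVec w)
    (by rw [Fintype.card_option, Fintype.card_fin, hrank]; norm_num)
  rw [Fintype.sum_option] at hsum
  simp only [Option.elim] at hsum
  rw [← hcomb] at hsum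
  set p := comb fun i => h (some i) with hp
  have hh0 : h none ≠ 0 := by
    intro h0
    rw [h0, map_zero, zero_smul, zero_add] at hsum
    have := hcomb0 _ (htf _ hsum)
    cases i with
    | none => exact hi h0
    | some i => exact hi (this i)
  have hpw : (Φ p).mulVec w = (-(aeval s (h none) * y)) • w := by
    rw [neg_smul, mul_smul]
    exact (neg_eq_of_add_eq_zero_right hsum).symm
  have hpp : p * p = (h none * h none * (C a - C (a * b) * X ^ 2 : k[X])).map (algebraMap k D) := by
    rw [← sub_eq_zero]
    apply htf
    rw [map_sub, hΦmap, map_mul, Matrix.sub_mulVec, ← Matrix.mulVec_mulVec, hpw,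
      Matrix.mulVec_smul, hpw, Algebra.algebraMap_eq_smul_one, Matrix.smul_mulVec,
      Matrix.one_mulVec, smul_smul, ← sub_smul, map_mul, ← hy, map_mul]
    convert zero_smul K w using 2
    ring
  obtain ⟨g, hg⟩ := exists_mul_self_eq_map hh0 hpp
  obtain ⟨I, J, hI, hJ, hIJ⟩ := exists_quaternion_basis_of_mul_self_eq ha hg
  obtain ⟨f⟩ := quaternionAlgebra_algEquiv_of_basis h2 ha hb hrank I J hI hJ hIJ
  exact ⟨f.symm⟩

/-- **Witt**: the central simple algebras split by the function field of a conic. -/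
theorem splitsIn_conic_iff (h2 : (2 : k) ≠ 0) {a b : k} (ha : a ≠ 0)
    (hb : b ≠ 0) {s t : K}
    (hst : algebraMap k K a * t ^ 2 + algebraMap k K b * s ^ 2 = 1)
    (htop : IntermediateField.adjoin k {s, t} = ⊤) (hs : Transcendental k s)
    (A : Type*) [Ring A] [Algebra k A] [IsSimpleRing A] [FiniteDimensional k A] :
    SplitsIn k A K ↔ IsSplitAlg k A ∨ BrauerEquiv k A ℍ[k,a,b] := by
  constructor
  · rintro ⟨N, hN, ⟨e⟩⟩
    have : IsArtinianRing A := IsArtinianRing.of_finite k A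
    obtain ⟨q, hq, D, _, _, _, ⟨f⟩⟩ :=
      IsSimpleRing.exists_algEquiv_matrix_divisionRing_finite k A
    have hq0 : 0 < q := NeZero.pos q
    have hD : SplitsIn k D K := isSplitAlg_of_matrix hq0 hN
      (((baseChangeMatrix k K D (Fin q)).symm.trans
        (Algebra.TensorProduct.congr AlgEquiv.refl f.symm)).trans e)
    rcases finrank_eq_one_or_algEquiv_quaternionAlgebra h2 ha hb hst htop hs hD with h1 | ⟨⟨g⟩⟩
    · left
      have hbij : Function.Bijective (Algebra.ofId k D) :=
        ⟨(algebraMap k D).injective, (LinearMap.injective_iff_surjective_of_finrank_eq_finrank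
          (f := (Algebra.ofId k D).toLinearMap) (by rw [h1, Module.finrank_self])).1
            (algebraMap k D).injective⟩
      exact ⟨q, hq0, ⟨f.trans (AlgEquiv.ofBijective _ hbij).symm.mapMatrix⟩⟩
    · right
      exact ⟨1, 1 * q, one_pos, Nat.mul_pos one_pos hq0,
        ⟨(f.mapMatrix.trans (matrixMatrixFin k D 1 q)).trans g.mapMatrix⟩⟩
  · rintro (h | h)
    · exact h.splitsIn K
    · exact isSplitAlg_of_brauerEquiv (h.baseChange K) (splitsIn_quaternionAlgebra h2 ha hb hst)

end FunctionField

section ConicCoordinateRing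

open Polynomial

variable {k : Type*} [Field k]

/-- The identification of `k[x₀, x₁]` with `k[X][T]` sending `x₀` to `T` and `x₁` to `X`. -/
def mvPolynomialFinTwoEquiv (k : Type*) [Field k] : MvPolynomial (Fin 2) k ≃ₐ[k] k[X][X] :=
  (MvPolynomial.finSuccEquiv k 1).trans
    (Polynomial.mapAlgEquiv (MvPolynomial.uniqueAlgEquiv k (Fin 1)))

theorem mvPolynomialFinTwoEquiv_C (c : k) :
    mvPolynomialFinTwoEquiv k (MvPolynomial.C c) = C (C c) :=
  (mvPolynomialFinTwoEquiv k).commutes c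

theorem mvPolynomialFinTwoEquiv_X_zero : mvPolynomialFinTwoEquiv k (MvPolynomial.X 0) = X := by
  simp [mvPolynomialFinTwoEquiv, MvPolynomial.finSuccEquiv_X_zero]

theorem mvPolynomialFinTwoEquiv_X_one :
    mvPolynomialFinTwoEquiv k (MvPolynomial.X 1) = C X := by
  have : (MvPolynomial.X 1 : MvPolynomial (Fin 2) k) = MvPolynomial.X (Fin.succ 0) := rfl
  rw [this]
  simp only [mvPolynomialFinTwoEquiv, AlgEquiv.trans_apply, MvPolynomial.finSuccEquiv_X_succ]
  simp

theorem mvPolynomialFinTwoEquiv_conic {a : k} (b : k) (ha : a ≠ 0) :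
    mvPolynomialFinTwoEquiv k (MvPolynomial.C a * MvPolynomial.X 0 ^ 2 +
      MvPolynomial.C b * MvPolynomial.X 1 ^ 2 - 1) =
    C (C a) * (X ^ 2 - C (C a⁻¹ * (1 - C b * X ^ 2))) := by
  have h : (C (C a) * C (C a⁻¹) : k[X][X]) = 1 := by
    rw [← C_mul, ← C_mul, mul_inv_cancel₀ ha, C_1, C_1]
  simp only [map_sub, map_add, map_mul, map_pow, map_one, mvPolynomialFinTwoEquiv_C,
    mvPolynomialFinTwoEquiv_X_zero, mvPolynomialFinTwoEquiv_X_one]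
  linear_combination (1 - C (C b) * C X ^ 2) * h

theorem not_exists_mul_self_eq_conic (h2 : (2 : k) ≠ 0) {a b : k} (ha : a ≠ 0) (hb : b ≠ 0)
    (r : k[X]) : r * r ≠ C a⁻¹ * (1 - C b * X ^ 2) := by
  intro hr
  have hdeg : r.natDegree ≤ 1 := by
    have h1 : (r * r).natDegree ≤ 2 := by
      rw [hr]
      compute_degree
    rw [← pow_two, natDegree_pow] at h1
    omega
  obtain ⟨β, α, rfl⟩ := exists_eq_X_add_C_of_natDegree_le_one hdeg
  have hexp : (C β * X + C α) * (C β * X + C α) =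
      C (β * β) * X ^ 2 + C (2 * (α * β)) * X + C (α * α) := by
    simp only [C_mul, map_ofNat]
    ring
  have hexp' : C a⁻¹ * (1 - C b * X ^ 2) = C a⁻¹ - C (a⁻¹ * b) * X ^ 2 := by
    simp only [C_mul]
    ring
  rw [hexp, hexp'] at hr
  have c0 := congrArg (fun f => coeff f 0) hr
  have c1 := congrArg (fun f => coeff f 1) hr
  have c2 := congrArg (fun f => coeff f 2) hr
  simp [coeff_X, coeff_C, coeff_X_pow, -map_mul] at c0 c1 c2
  rcases c1 with c1 | c1 | c1
  · exact h2 c1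
  · rw [c1, mul_zero, zero_eq_inv] at c0
    exact ha c0.symm
  · simp [c1, ha, hb] at c2

theorem isDomain_conicCoordRing (h2 : (2 : k) ≠ 0) {a b : k} (ha : a ≠ 0) (hb : b ≠ 0) :
    IsDomain (conicCoordRing k a b) := by
  have hirr : Irreducible (X ^ 2 - C (C a⁻¹ * (1 - C b * X ^ 2)) : k[X][X]) := by
    have hmonic := monic_X_pow_sub_C (C a⁻¹ * (1 - C b * X ^ 2) : k[X]) two_ne_zero
    rw [hmonic.irreducible_iff_roots_eq_zero_of_degree_le_three
      (by rw [natDegree_X_pow_sub_C]) (by rw [natDegree_X_pow_sub_C]; norm_num)]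
    refine Multiset.eq_zero_of_forall_notMem fun r hr => ?_
    have h := (mem_roots hmonic.ne_zero).1 hr
    rw [IsRoot.def, eval_sub, eval_pow, eval_X, eval_C, sub_eq_zero, pow_two] at h
    exact not_exists_mul_self_eq_conic h2 ha hb r h
  have hirr' : Irreducible (MvPolynomial.C a * MvPolynomial.X 0 ^ 2 +
      MvPolynomial.C b * MvPolynomial.X 1 ^ 2 - 1 : MvPolynomial (Fin 2) k) := by
    rw [← MulEquiv.irreducible_iff (mvPolynomialFinTwoEquiv k), mvPolynomialFinTwoEquiv_conic b ha]
    have hu : IsUnit (C (C a) : k[X][X]) := ((IsUnit.mk0 a ha).map C).map C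
    exact (irreducible_isUnit_mul hu).2 hirr
  have hprime : (Ideal.span {(MvPolynomial.C a * MvPolynomial.X 0 ^ 2 +
      MvPolynomial.C b * MvPolynomial.X 1 ^ 2 - 1 : MvPolynomial (Fin 2) k)}).IsPrime :=
    (Ideal.span_singleton_prime hirr'.ne_zero).2 hirr'.prime
  exact Ideal.Quotient.isDomain _

/-- The coordinate functions on the conic. -/
def conicCoord (a b : k) (i : Fin 2) : conicFunctionField k a b :=
  algebraMap (conicCoordRing k a b) _ (Ideal.Quotient.mk _ (MvPolynomial.X i))

theorem algebraMap_mk_eq_aeval_conicCoord (a b : k) (p : MvPolynomial (Fin 2) k) :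
    algebraMap (conicCoordRing k a b) (conicFunctionField k a b) (Ideal.Quotient.mk _ p) =
      MvPolynomial.aeval (conicCoord a b) p := by
  have : ((IsScalarTower.toAlgHom k (conicCoordRing k a b) (conicFunctionField k a b)).comp
      (Ideal.Quotient.mkₐ k _)) = MvPolynomial.aeval (conicCoord a b) := by
    ext i
    simp [conicCoord]
  exact DFunLike.congr_fun this p

theorem conicCoord_relation (a b : k) :
    algebraMap k _ a * conicCoord a b 0 ^ 2 + algebraMap k _ b * conicCoord a b 1 ^ 2 = 1 := by
  have h := algebraMap_mk_eq_aeval_conicCoord a b (MvPolynomial.C a * MvPolynomial.X 0 ^ 2 +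
      MvPolynomial.C b * MvPolynomial.X 1 ^ 2 - 1)
  rw [Ideal.Quotient.eq_zero_iff_mem.2 (Ideal.mem_span_singleton_self _), map_zero] at h
  simp only [map_sub, map_add, map_mul, map_pow, map_one, MvPolynomial.aeval_C,
    MvPolynomial.aeval_X] at h
  exact (sub_eq_zero.1 h.symm)

theorem transcendental_conicCoord_one {a : k} (b : k) (ha : a ≠ 0) :
    Transcendental k (conicCoord a b 1) := by
  rw [transcendental_iff]
  intro h hh
  have h1 : algebraMap (conicCoordRing k a b) (conicFunctionField k a b)
      (Ideal.Quotient.mk _ (aeval (MvPolynomial.X 1) h)) = 0 := by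
    rw [algebraMap_mk_eq_aeval_conicCoord, ← Polynomial.aeval_algHom_apply, MvPolynomial.aeval_X,
      hh]
  rw [map_eq_zero_iff _ (IsFractionRing.injective _ _), Ideal.Quotient.eq_zero_iff_mem,
    Ideal.mem_span_singleton] at h1
  have h2 := map_dvd (mvPolynomialFinTwoEquiv k) h1
  have hC : mvPolynomialFinTwoEquiv k (aeval (MvPolynomial.X 1) h) = C h := by
    rw [← Polynomial.aeval_algHom_apply, mvPolynomialFinTwoEquiv_X_one]
    have := Polynomial.aeval_algHom_apply (Algebra.ofId k[X] k[X][X] |>.restrictScalars k) X h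
    rw [aeval_X_left_apply] at this
    exact this
  rw [mvPolynomialFinTwoEquiv_conic b ha, hC] at h2
  by_contra hne
  have hdeg := natDegree_le_of_dvd ((Dvd.intro_left _ rfl).trans h2) (C_ne_zero.2 hne)
  rw [natDegree_X_pow_sub_C, natDegree_C] at hdeg
  omega

theorem adjoin_conicCoord_eq_top (a b : k) [IsDomain (conicCoordRing k a b)] :
    IntermediateField.adjoin k {conicCoord a b 1, conicCoord a b 0} = ⊤ := by
  rw [eq_top_iff]
  rintro x -
  obtain ⟨p, q, -, rfl⟩ := IsFractionRing.div_surjective (A := conicCoordRing k a b) x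
  have hmem : ∀ p : conicCoordRing k a b, algebraMap _ (conicFunctionField k a b) p ∈
      IntermediateField.adjoin k {conicCoord a b 1, conicCoord a b 0} := by
    intro p
    obtain ⟨p, rfl⟩ := Ideal.Quotient.mk_surjective p
    rw [algebraMap_mk_eq_aeval_conicCoord]
    induction p using MvPolynomial.induction_on with
    | C c =>
      rw [MvPolynomial.aeval_C]
      exact IntermediateField.algebraMap_mem _ c
    | add p q hp hq =>
      rw [map_add]
      exact add_mem hp hq
    | mul_X p i hp =>
      rw [map_mul, MvPolynomial.aeval_X]
      refine mul_mem hp (IntermediateField.subset_adjoin _ _ ?_)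
      fin_cases i <;> simp
  exact div_mem (hmem p) (hmem q)

end ConicCoordinateRing

theorem stmt_2 (k : Type u) [Field k] (h2 : (2 : k) ≠ 0) (a b : k) (ha : a ≠ 0) (hb : b ≠ 0) :
    (∀ (A : Type u) [Ring A] [Algebra k A] [Algebra.IsCentral k A] [IsSimpleRing A]
        [FiniteDimensional k A],
      SplitsIn k A (conicFunctionField k a b) ↔
        (IsSplitAlg k A ∨ BrauerEquiv k A (ℍ[k,a,b]))) ∧
    ((∀ (A : Type u) [Ring A] [Algebra k A] [Algebra.IsCentral k A] [IsSimpleRing A]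
        [FiniteDimensional k A],
      SplitsIn k A (conicFunctionField k a b) → IsSplitAlg k A) ↔ IsSplitAlg k (ℍ[k,a,b])) ∧
    (IsSplitAlg k (ℍ[k,a,b]) ↔
      ∃ x y z : k, ¬(x = 0 ∧ y = 0 ∧ z = 0) ∧ a * x ^ 2 + b * y ^ 2 = z ^ 2) := by
  have := isDomain_conicCoordRing h2 ha hb
  have hst := conicCoord_relation a b
  have main : ∀ (A : Type u) [Ring A] [Algebra k A] [IsSimpleRing A] [FiniteDimensional k A],
      SplitsIn k A (conicFunctionField k a b) ↔
        (IsSplitAlg k A ∨ BrauerEquiv k A (ℍ[k,a,b])) := fun A _ _ _ _ =>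
    splitsIn_conic_iff h2 ha hb hst (adjoin_conicCoord_eq_top a b)
      (transcendental_conicCoord_one b ha) A
  refine ⟨fun A _ _ _ _ _ => main A, ⟨fun h => ?_, fun hH A _ _ _ _ _ hA => ?_⟩,
    isSplitAlg_quaternionAlgebra_iff h2 ha hb⟩
  · have := isSimpleRing_quaternionAlgebra h2 ha hb
    have := isCentral_quaternionAlgebra h2 (b := b) ha
    exact h ℍ[k,a,b] (splitsIn_quaternionAlgebra h2 ha hb hst)
  · exact ((main A).1 hA).elim id fun h => isSplitAlg_of_brauerEquiv h hH

end
end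

section
/- Let k be a field of characteristic ≠ 2 and a, b, c, d ∈ k×. Suppose the quaternion algebra ℍ(a,b) is a division algebra (equivalently, the conic aX² + bY² = Z² has no k-rational point). If there exists a k-algebra homomorphism k(C_{a,b}) → k(C_{c,d}), then k(C_{a,b}) and k(C_{c,d}) are isomorphic as k-algebras. In other words, a genus zero curve without a k-rational point is not dominated by any nonisomorphic genus zero curve. -/
open scoped TensorProduct
open Quaternion
set_option synthInstance.maxHeartbeats 1000000
set_option maxHeartbeats 1000000
noncomputable section

universe u v

open Polynomial

/-- The ternary diagonal form `⟨a, b, -ab⟩` has no nontrivial zero in `R`. -/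
def PureAnisotropic {R : Type*} [CommRing R] (a b : R) : Prop :=
  ∀ f g h : R, a * f ^ 2 + b * g ^ 2 - a * b * h ^ 2 = 0 → f = 0 ∧ g = 0 ∧ h = 0

theorem pureAnisotropic_of_division {k : Type*} [Field k] {a b : k}
    (hdiv : ∀ x : QuaternionAlgebra k a 0 b, x ≠ 0 → IsUnit x) : PureAnisotropic a b := by
  intro f g h hz
  let t : QuaternionAlgebra k a 0 b := ⟨0, f, g, h⟩
  have ht : t * t = 0 := by
    ext <;> simp [t]
    · linear_combination hz
    all_goals ring
  have h0 : t = 0 := by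
    by_contra hne
    exact hne (((hdiv t hne).mul_right_eq_zero).1 ht)
  exact ⟨congrArg QuaternionAlgebra.imI h0, congrArg QuaternionAlgebra.imJ h0,
    congrArg QuaternionAlgebra.imK h0⟩

section CasselsPfister

variable {k : Type*} [Field k] {a b : k}

theorem natDegree_le_of_pureForm (H : PureAnisotropic a b) {m : ℕ} {f g h : k[X]}
    (hd : (C a * f ^ 2 + C b * g ^ 2 - C a * C b * h ^ 2).natDegree ≤ 2 * m) :
    f.natDegree ≤ m ∧ g.natDegree ≤ m ∧ h.natDegree ≤ m := by
  suffices key : ∀ n, f.natDegree ≤ m + n → g.natDegree ≤ m + n → h.natDegree ≤ m + n →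
      f.natDegree ≤ m ∧ g.natDegree ≤ m ∧ h.natDegree ≤ m from
    key (f.natDegree + g.natDegree + h.natDegree) (by omega) (by omega) (by omega)
  intro n
  induction n with
  | zero => exact fun hf hg hh => ⟨hf, hg, hh⟩
  | succ n ih =>
    intro hf hg hh
    have hc := coeff_eq_zero_of_natDegree_lt (lt_of_le_of_lt hd
      (show 2 * m < 2 * (m + (n + 1)) by omega))
    simp only [coeff_sub, coeff_add, ← C_mul, coeff_C_mul,
      coeff_pow_of_natDegree_le hf, coeff_pow_of_natDegree_le hg,
      coeff_pow_of_natDegree_le hh] at hc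
    obtain ⟨h1, h2, h3⟩ := H _ _ _ hc
    have drop : ∀ p : k[X], p.natDegree ≤ m + (n + 1) → p.coeff (m + (n + 1)) = 0 →
        p.natDegree ≤ m + n := by
      intro p hp hp0
      by_contra hlt
      have : p.natDegree = m + (n + 1) := by omega
      rw [← this, coeff_natDegree, leadingCoeff_eq_zero] at hp0
      simp [hp0] at hlt
    exact ih (drop f hf h1) (drop g hg h2) (drop h hh h3)

theorem PureAnisotropic.polynomial (H : PureAnisotropic a b) :
    PureAnisotropic (C a) (C b) := by
  intro f g h hz
  obtain ⟨hf, hg, hh⟩ := natDegree_le_of_pureForm (m := 0) H (by rw [hz]; simp)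
  rw [eq_C_of_natDegree_le_zero hf, eq_C_of_natDegree_le_zero hg,
    eq_C_of_natDegree_le_zero hh] at hz ⊢
  simp only [← C_mul, ← C_pow, ← C_add, ← C_sub, C_eq_zero] at hz ⊢
  exact H _ _ _ hz

theorem exists_common_denominator_three {R K : Type*} [CommRing R] [IsDomain R] [Field K]
    [Algebra R K] [IsFractionRing R K] (f g h : K) :
    ∃ s f' g' h' : R, s ≠ 0 ∧ algebraMap R K f' = algebraMap R K s * f ∧
      algebraMap R K g' = algebraMap R K s * g ∧ algebraMap R K h' = algebraMap R K s * h := by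
  classical
  obtain ⟨s, hs⟩ := IsLocalization.exist_integer_multiples_of_finset (nonZeroDivisors R)
    ({f, g, h} : Finset K)
  simp only [Finset.mem_insert, Finset.mem_singleton, forall_eq_or_imp, forall_eq,
    IsLocalization.IsInteger, RingHom.mem_rangeS, Algebra.smul_def] at hs
  obtain ⟨⟨f', hf⟩, ⟨g', hg⟩, ⟨h', hh⟩⟩ := hs
  exact ⟨s, f', g', h', nonZeroDivisors.ne_zero s.2, hf, hg, hh⟩

theorem PureAnisotropic.fractionRing {R K : Type*} [CommRing R] [IsDomain R] [Field K]
    [Algebra R K] [IsFractionRing R K] {a b : R} (H : PureAnisotropic a b) :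
    PureAnisotropic (algebraMap R K a) (algebraMap R K b) := by
  intro f g h hz
  obtain ⟨s, f', g', h', hs, hf, hg, hh⟩ := exists_common_denominator_three (R := R) f g h
  have hs0 : algebraMap R K s ≠ 0 := by simpa using hs
  obtain ⟨rfl, rfl, rfl⟩ := H f' g' h' (by
    apply IsFractionRing.injective R K
    simp only [map_add, map_sub, map_mul, map_pow, map_zero, hf, hg, hh]
    linear_combination (algebraMap R K s) ^ 2 * hz)
  simpa [hs0] using And.intro hf (And.intro hg hh)

/-- The Cassels–Pfister theorem for an anisotropic form `⟨a, b, -ab⟩`: a polynomial represented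
over `k(X)`, with denominator `g`, is represented over `k[X]`. -/
theorem exists_polynomial_of_pureForm_eq_sq_mul (H : PureAnisotropic a b) (p : k[X]) :
    ∀ (n : ℕ) (g f₁ f₂ f₃ : k[X]), g ≠ 0 → g.natDegree ≤ n →
      C a * f₁ ^ 2 + C b * f₂ ^ 2 - C a * C b * f₃ ^ 2 = g ^ 2 * p →
      ∃ h₁ h₂ h₃ : k[X], C a * h₁ ^ 2 + C b * h₂ ^ 2 - C a * C b * h₃ ^ 2 = p := by
  intro n
  induction n with
  | zero =>
    intro g f₁ f₂ f₃ hg hn hf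
    obtain ⟨c, rfl⟩ : ∃ c, g = C c := ⟨_, eq_C_of_natDegree_le_zero hn⟩
    have hc : C c⁻¹ * C c = 1 := by
      rw [← C_mul, inv_mul_cancel₀ (by simpa using hg), C_1]
    refine ⟨C c⁻¹ * f₁, C c⁻¹ * f₂, C c⁻¹ * f₃, ?_⟩
    linear_combination C c⁻¹ ^ 2 * hf + p * (C c⁻¹ * C c + 1) * hc
  | succ n ih =>
    intro g f₁ f₂ f₃ hg hn hf
    by_cases hn' : g.natDegree ≤ n
    · exact ih g f₁ f₂ f₃ hg hn' hf
    have hgn : g.natDegree = n + 1 := by omega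
    have hlt : ∀ f : k[X], (f % g).natDegree ≤ n := fun f => by
      have := natDegree_mod_lt f (q := g) (by omega)
      omega
    have e₁ := EuclideanDomain.div_add_mod f₁ g
    have e₂ := EuclideanDomain.div_add_mod f₂ g
    have e₃ := EuclideanDomain.div_add_mod f₃ g
    have d₁ := hlt f₁
    have d₂ := hlt f₂
    have d₃ := hlt f₃
    generalize f₁ / g = h₁ at *
    generalize f₂ / g = h₂ at *
    generalize f₃ / g = h₃ at *
    generalize f₁ % g = r₁ at *
    generalize f₂ % g = r₂ at *
    generalize f₃ % g = r₃ at *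
    set A := C a * h₁ ^ 2 + C b * h₂ ^ 2 - C a * C b * h₃ ^ 2 - p with hA
    set B := 2 * (g * p - (C a * f₁ * h₁ + C b * f₂ * h₂ - C a * C b * f₃ * h₃)) with hB
    have hgg : g * (A * g + B) = C a * r₁ ^ 2 + C b * r₂ ^ 2 - C a * C b * r₃ ^ 2 := by
      rw [hA, hB]
      obtain rfl : r₁ = f₁ - g * h₁ := by linear_combination e₁
      obtain rfl : r₂ = f₂ - g * h₂ := by linear_combination e₂
      obtain rfl : r₃ = f₃ - g * h₃ := by linear_combination e₃
      linear_combination -hf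
    by_cases hg' : A * g + B = 0
    · rw [hg', mul_zero] at hgg
      obtain ⟨rfl, rfl, rfl⟩ := H.polynomial _ _ _ hgg.symm
      refine ⟨h₁, h₂, h₃, mul_left_cancel₀ (pow_ne_zero 2 hg) ?_⟩
      rw [← hf, ← e₁, ← e₂, ← e₃]
      ring
    · refine ih (A * g + B) (A * f₁ + B * h₁) (A * f₂ + B * h₂) (A * f₃ + B * h₃) hg' ?_ ?_
      · have hsq : ∀ r : k[X], r.natDegree ≤ n → (r ^ 2).natDegree ≤ 2 * n := fun r hr =>
          natDegree_pow_le_of_le 2 hr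
        have hdeg : (C a * r₁ ^ 2 + C b * r₂ ^ 2 - C a * C b * r₃ ^ 2).natDegree ≤ 2 * n := by
          rw [← C_mul]
          exact (natDegree_sub_le_of_le (natDegree_add_le_of_degree_le
            ((natDegree_C_mul_le _ _).trans (hsq _ d₁)) ((natDegree_C_mul_le _ _).trans (hsq _ d₂)))
            ((natDegree_C_mul_le _ _).trans (hsq _ d₃))).trans_eq (max_self _)
        rw [← hgg, natDegree_mul hg hg'] at hdeg
        omega
      · linear_combination A ^ 2 * hf - A * B * hB + B ^ 2 * hA

end CasselsPfister

section QuadraticModel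

variable {k : Type*} [Field k]

theorem eq_zero_of_quadratic_eq_zero {r s t : k}
    (h : C r * X ^ 2 + C s * X + C t = 0) : r = 0 ∧ s = 0 ∧ t = 0 := by
  have c0 := congrArg (coeff · 0) h
  have c1 := congrArg (coeff · 1) h
  have c2 := congrArg (coeff · 2) h
  simp [coeff_X, coeff_C] at c0 c1 c2
  exact ⟨c2, c1, c0⟩

theorem eq_zero_of_C_mul_sq_eq {a b : k} (h2 : (2 : k) ≠ 0) (ha : a ≠ 0) (hb : b ≠ 0)
    {p q : k[X]} (h : C b * p ^ 2 = q ^ 2 * (1 - C a * X ^ 2)) : p = 0 ∧ q = 0 := by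
  by_cases hq : q = 0
  · subst hq
    simpa [hb] using h
  exfalso
  have hdvd : q ∣ C b * p := by
    rw [← IsIntegrallyClosed.pow_dvd_pow_iff two_ne_zero]
    exact ⟨C b * (1 - C a * X ^ 2), by linear_combination C b * h⟩
  obtain ⟨r, hr⟩ := hdvd
  have hr2 : r ^ 2 = C b * (1 - C a * X ^ 2) := by
    apply mul_left_cancel₀ (pow_ne_zero 2 hq)
    linear_combination C b * h - (q * r + C b * p) * hr
  have hdeg : r.natDegree ≤ 1 := by
    have h3 : (r ^ 2).natDegree ≤ 2 := by rw [hr2]; compute_degree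
    rw [natDegree_pow] at h3
    omega
  obtain ⟨s, t, rfl⟩ := exists_eq_X_add_C_of_natDegree_le_one hdeg
  have e : C (s ^ 2 + a * b) * X ^ 2 + C (2 * s * t) * X + C (t ^ 2 - b) = 0 := by
    simp only [map_add, map_mul, map_sub, map_pow, C_ofNat]
    linear_combination hr2
  obtain ⟨c2, c1, c0⟩ := eq_zero_of_quadratic_eq_zero e
  rcases mul_eq_zero.1 c1 with c1 | rfl
  · obtain rfl : s = 0 := by simpa [h2] using c1
    simp [ha, hb] at c2
  · simp [hb] at c0

/-- `x` and `y` generate the field `L` over `k`, `x` is transcendental, and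
`a * x ^ 2 + b * y ^ 2 = 1`. -/
structure IsConicGenerator {L : Type*} [Field L] [Algebra k L] (a b : k) (x y : L) : Prop where
  equation : algebraMap k L a * x ^ 2 + algebraMap k L b * y ^ 2 = 1
  transcendental : Transcendental k x
  adjoin_eq_top : IntermediateField.adjoin k {x, y} = ⊤

/-- The square of the second coordinate of the conic, as a rational function of the first. -/
noncomputable def conicRadicand (a b : k) : FractionRing k[X] :=
  algebraMap k[X] _ (C b⁻¹ * (1 - C a * X ^ 2))

theorem sq_ne_conicRadicand {a b : k} (h2 : (2 : k) ≠ 0) (ha : a ≠ 0) (hb : b ≠ 0)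
    (z : FractionRing k[X]) : z ^ 2 ≠ conicRadicand a b := by
  intro hz
  obtain ⟨p, q, hq, rfl⟩ := IsFractionRing.div_surjective (A := k[X]) z
  have hq0 : algebraMap k[X] (FractionRing k[X]) q ≠ 0 :=
    IsFractionRing.to_map_ne_zero_of_mem_nonZeroDivisors hq
  rw [div_pow, div_eq_iff (pow_ne_zero 2 hq0), conicRadicand, ← map_pow, ← map_pow,
    ← map_mul] at hz
  have h := IsFractionRing.injective k[X] (FractionRing k[X]) hz
  have hbb : (C b : k[X]) * C b⁻¹ = 1 := by rw [← C_mul, mul_inv_cancel₀ hb, C_1]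
  refine nonZeroDivisors.ne_zero hq (eq_zero_of_C_mul_sq_eq (p := p) h2 ha hb ?_).2
  linear_combination C b * h + q ^ 2 * (1 - C a * X ^ 2) * hbb

/-- A model of the conic function field as a quadratic extension of `k(x)`. -/
abbrev ConicQuadraticModel (a b : k) : Type _ :=
  AdjoinRoot (X ^ 2 - C (conicRadicand a b))

theorem irreducible_X_sq_sub_conicRadicand {a b : k} (h2 : (2 : k) ≠ 0) (ha : a ≠ 0) (hb : b ≠ 0) :
    Irreducible (X ^ 2 - C (conicRadicand a b)) :=
  X_pow_sub_C_irreducible_of_prime Nat.prime_two (sq_ne_conicRadicand h2 ha hb)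

namespace ConicQuadraticModel

variable (a b : k)

/-- The first coordinate function. -/
noncomputable def x : ConicQuadraticModel a b :=
  algebraMap (FractionRing k[X]) _ (algebraMap k[X] _ X)

/-- The second coordinate function. -/
noncomputable def y : ConicQuadraticModel a b := AdjoinRoot.root _

theorem y_sq : y a b ^ 2 = algebraMap (FractionRing k[X]) _ (conicRadicand a b) := by
  have h := AdjoinRoot.eval₂_root (X ^ 2 - C (conicRadicand a b))
  rw [eval₂_sub, eval₂_pow, eval₂_X, eval₂_C, sub_eq_zero] at h
  exact h

theorem exists_eq_add_mul_y (z : ConicQuadraticModel a b) :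
    ∃ s t : FractionRing k[X],
      z = algebraMap (FractionRing k[X]) _ s + algebraMap (FractionRing k[X]) _ t * y a b := by
  obtain ⟨p, rfl⟩ := AdjoinRoot.mk_surjective z
  have hm : (X ^ 2 - C (conicRadicand a b)).Monic := monic_X_pow_sub_C _ two_ne_zero
  have hdeg : (p %ₘ (X ^ 2 - C (conicRadicand a b))).natDegree ≤ 1 := by
    have := natDegree_modByMonic_lt p hm (fun h => by simpa using congrArg natDegree h)
    rw [natDegree_X_pow_sub_C] at this
    omega
  obtain ⟨t, s, hts⟩ := exists_eq_X_add_C_of_natDegree_le_one hdeg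
  refine ⟨s, t, ?_⟩
  conv_lhs => rw [← modByMonic_add_div p (X ^ 2 - C (conicRadicand a b)), hts]
  simp [y, AdjoinRoot.algebraMap_eq, add_comm]

variable {a b}

theorem eq_zero_of_add_mul_y_eq_zero [Fact (Irreducible (X ^ 2 - C (conicRadicand a b)))]
    (h2 : (2 : k) ≠ 0) (ha : a ≠ 0) (hb : b ≠ 0) {s t : FractionRing k[X]}
    (h : algebraMap _ (ConicQuadraticModel a b) s +
      algebraMap _ (ConicQuadraticModel a b) t * y a b = 0) :
    s = 0 ∧ t = 0 := by
  have ht : t = 0 := by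
    by_contra ht
    apply sq_ne_conicRadicand h2 ha hb (s / t)
    have hinj := (algebraMap (FractionRing k[X]) (ConicQuadraticModel a b)).injective
    apply hinj
    rw [← y_sq, map_pow, map_div₀, div_pow, div_eq_iff (by simpa using ht)]
    linear_combination (algebraMap _ (ConicQuadraticModel a b) s -
      algebraMap _ (ConicQuadraticModel a b) t * y a b) * h
  subst ht
  simpa using h

theorem isConicGenerator [Fact (Irreducible (X ^ 2 - C (conicRadicand a b)))] (hb : b ≠ 0) :
    IsConicGenerator a b (x a b) (y a b) where
  equation := by
    have hy : y a b ^ 2 = algebraMap (FractionRing k[X]) _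
      (algebraMap k[X] _ (C b⁻¹ * (1 - C a * X ^ 2))) := y_sq a b
    rw [hy, x, ← map_pow, ← map_pow,
      IsScalarTower.algebraMap_apply k (FractionRing k[X]) (ConicQuadraticModel a b),
      IsScalarTower.algebraMap_apply k (FractionRing k[X]) (ConicQuadraticModel a b),
      IsScalarTower.algebraMap_apply k k[X] (FractionRing k[X]),
      IsScalarTower.algebraMap_apply k k[X] (FractionRing k[X]), ← map_mul, ← map_mul, ← map_mul,
      ← map_mul, ← map_add, ← map_add, algebraMap_eq]
    have hbb : (C b : k[X]) * C b⁻¹ = 1 := by rw [← C_mul, mul_inv_cancel₀ hb, C_1]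
    rw [show C a * X ^ 2 + C b * (C b⁻¹ * (1 - C a * X ^ 2)) = 1 by
      linear_combination (1 - C a * X ^ 2) * hbb, map_one, map_one]
  transcendental := by
    rw [x, transcendental_iff]
    intro p hp
    rw [aeval_algebraMap_apply, aeval_algebraMap_apply, aeval_X_left_apply] at hp
    simpa using hp
  adjoin_eq_top := by
    rw [eq_top_iff]
    rintro z -
    set E := IntermediateField.adjoin k {x a b, y a b}
    have hx : x a b ∈ E := IntermediateField.subset_adjoin _ _ (by simp)
    have hy : y a b ∈ E := IntermediateField.subset_adjoin _ _ (by simp)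
    have hp : ∀ p : k[X],
        algebraMap (FractionRing k[X]) (ConicQuadraticModel a b) (algebraMap _ _ p) ∈ E := by
      intro p
      rw [show algebraMap (FractionRing k[X]) (ConicQuadraticModel a b) (algebraMap _ _ p) =
          aeval (x a b) p by
        rw [x, aeval_algebraMap_apply, aeval_algebraMap_apply, aeval_X_left_apply]]
      exact Algebra.adjoin_le (S := E.toSubalgebra) (by simpa using hx)
        (aeval_mem_adjoin_singleton k (x a b))
    have hs : ∀ s, algebraMap (FractionRing k[X]) (ConicQuadraticModel a b) s ∈ E := by
      intro s
      obtain ⟨p, q, -, rfl⟩ := IsFractionRing.div_surjective (A := k[X]) s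
      rw [map_div₀]
      exact E.div_mem (hp p) (hp q)
    obtain ⟨s, t, rfl⟩ := exists_eq_add_mul_y a b z
    exact E.add_mem (hs s) (E.mul_mem (hs t) hy)

end ConicQuadraticModel

end QuadraticModel

section ConicGenerator

variable {k : Type*} [Field k] {a b : k}

theorem exists_aeval_add_aeval_mul_eq (hb : b ≠ 0) (z : conicCoordRing k a b) :
    ∃ p q : k[X],
      z = aeval (Ideal.Quotient.mk _ (MvPolynomial.X 0) : conicCoordRing k a b) p +
        aeval (Ideal.Quotient.mk _ (MvPolynomial.X 0) : conicCoordRing k a b) q *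
          Ideal.Quotient.mk _ (MvPolynomial.X 1) := by
  obtain ⟨P, rfl⟩ := Ideal.Quotient.mk_surjective z
  have hrel : algebraMap k (conicCoordRing k a b) a *
      Ideal.Quotient.mk _ (MvPolynomial.X 0) ^ 2 + algebraMap k (conicCoordRing k a b) b *
      Ideal.Quotient.mk _ (MvPolynomial.X 1) ^ 2 = 1 := by
    rw [← sub_eq_zero]
    exact Ideal.Quotient.eq_zero_iff_mem.2 (Ideal.subset_span rfl)
  have hbb : algebraMap k (conicCoordRing k a b) b⁻¹ *
      algebraMap k (conicCoordRing k a b) b = 1 := by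
    rw [← map_mul, inv_mul_cancel₀ hb, map_one]
  induction P using MvPolynomial.induction_on with
  | C r => exact ⟨C r, 0, by simp; rfl⟩
  | add P Q hP hQ =>
    obtain ⟨p, q, h⟩ := hP
    obtain ⟨p', q', h'⟩ := hQ
    refine ⟨p + p', q + q', ?_⟩
    rw [map_add, h, h', map_add, map_add]
    ring
  | mul_X P i hP =>
    obtain ⟨p, q, h⟩ := hP
    fin_cases i
    · refine ⟨p * X, q * X, ?_⟩
      simp only [map_mul, h, aeval_X, Fin.zero_eta]
      ring
    · refine ⟨q * (C b⁻¹ * (1 - C a * X ^ 2)), p, ?_⟩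
      simp only [map_mul, h, aeval_X, Fin.mk_one, map_sub, map_one, map_pow, aeval_C]
      generalize aeval (Ideal.Quotient.mk _ (MvPolynomial.X 0) : conicCoordRing k a b) q = q' at *
      generalize algebraMap k (conicCoordRing k a b) b⁻¹ = b' at *
      linear_combination (b' * hrel - Ideal.Quotient.mk _ (MvPolynomial.X 1) ^ 2 * hbb) * q'

variable {L : Type*} [Field L] [Algebra k L]

/-- A field with conic generators is the function field of that conic. -/
theorem IsConicGenerator.nonempty_algEquiv (h2 : (2 : k) ≠ 0) (ha : a ≠ 0) (hb : b ≠ 0) {x y : L}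
    (hxy : IsConicGenerator a b x y) : Nonempty (conicFunctionField k a b ≃ₐ[k] L) := by
  let φ : conicCoordRing k a b →ₐ[k] L := Ideal.Quotient.liftₐ _ (MvPolynomial.aeval ![x, y]) (by
    intro P hP
    obtain ⟨Q, rfl⟩ := Ideal.mem_span_singleton'.1 hP
    simp [hxy.equation, ← MvPolynomial.algebraMap_eq])
  have hφ : ∀ P, φ (Ideal.Quotient.mk _ P) = MvPolynomial.aeval ![x, y] P := fun P =>
    Ideal.Quotient.lift_mk _ _ _
  have hinj : Function.Injective φ := by
    rw [injective_iff_map_eq_zero]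
    intro z hz
    obtain ⟨p, q, rfl⟩ := exists_aeval_add_aeval_mul_eq hb z
    rw [map_add, map_mul, ← aeval_algHom_apply, ← aeval_algHom_apply, hφ, hφ,
      MvPolynomial.aeval_X, MvPolynomial.aeval_X] at hz
    change aeval x p + aeval x q * y = 0 at hz
    have hpq : C b * p ^ 2 = q ^ 2 * (1 - C a * X ^ 2) := by
      rw [← sub_eq_zero]
      refine transcendental_iff.1 hxy.transcendental _ ?_
      simp only [map_sub, map_mul, map_pow, map_one, aeval_C, aeval_X]
      linear_combination algebraMap k L b * (aeval x p - aeval x q * y) * hz +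
        aeval x q ^ 2 * hxy.equation
    obtain ⟨rfl, rfl⟩ := eq_zero_of_C_mul_sq_eq h2 ha hb hpq
    simp
  let : Algebra (conicCoordRing k a b) L := φ.toRingHom.toAlgebra
  have : IsScalarTower k (conicCoordRing k a b) L :=
    IsScalarTower.of_algebraMap_eq fun r => (φ.commutes r).symm
  have : FaithfulSMul (conicCoordRing k a b) L :=
    (faithfulSMul_iff_algebraMap_injective _ _).2 hinj
  have : IsFractionRing (conicCoordRing k a b) L := by
    refine IsFractionRing.of_field _ _ fun z => ?_
    have hz : z ∈ IntermediateField.adjoin k (Set.range ![x, y]) := by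
      rw [Matrix.range_cons, Matrix.range_cons, Matrix.range_empty, Set.union_empty,
        Set.singleton_union, hxy.adjoin_eq_top]
      trivial
    obtain ⟨r, s, rfl⟩ := (IntermediateField.mem_adjoin_range_iff _ _ _).1 hz
    exact ⟨Ideal.Quotient.mk _ r, Ideal.Quotient.mk _ s, congrArg₂ _ (hφ r).symm (hφ s).symm⟩
  have : IsDomain (conicCoordRing k a b) := hinj.isDomain φ.toRingHom
  exact ⟨(FractionRing.algEquiv (conicCoordRing k a b) L).restrictScalars k⟩

theorem IsConicGenerator.eq_zero_of_linear_eq_zero (h2 : (2 : k) ≠ 0) (ha : a ≠ 0)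
    (hb : b ≠ 0) {x y : L}
    (hxy : IsConicGenerator a b x y) {r s t : k}
    (h : algebraMap k L r * x + algebraMap k L s * y + algebraMap k L t = 0) :
    r = 0 ∧ s = 0 ∧ t = 0 := by
  have hq : C (b * r ^ 2 + a * s ^ 2) * X ^ 2 + C (2 * b * r * t) * X +
      C (b * t ^ 2 - s ^ 2) = 0 := by
    refine transcendental_iff.1 hxy.transcendental _ ?_
    simp only [map_add, map_sub, map_mul, map_pow, aeval_C, aeval_X, map_ofNat]
    linear_combination algebraMap k L b *
        (algebraMap k L r * x - algebraMap k L s * y + algebraMap k L t) * h +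
      algebraMap k L s ^ 2 * hxy.equation
  obtain ⟨e2, e1, e0⟩ := eq_zero_of_quadratic_eq_zero hq
  have hrt : r = 0 ∨ t = 0 := by simpa [h2, hb] using e1
  rcases hrt with rfl | rfl
  · obtain rfl : s = 0 := by simpa [ha] using e2
    simpa [hb] using e0
  · obtain rfl : s = 0 := by simpa using e0
    simpa [hb] using e2

/-- Orthogonal vectors `u`, `v` of values `d`, `-cd` under `⟨a, b, -ab⟩` give a change of
coordinates between the conics `(a, b)` and `(c, d)`. -/
theorem conic_change_coordinates {a b c d x y u₁ u₂ u₃ v₁ v₂ v₃ V : L}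
    (ha : a ≠ 0) (hb : b ≠ 0) (hc : c ≠ 0) (hd : d ≠ 0)
    (hxy : a * x ^ 2 + b * y ^ 2 = 1)
    (hu : a * u₁ ^ 2 + b * u₂ ^ 2 - a * b * u₃ ^ 2 = d)
    (hv : a * v₁ ^ 2 + b * v₂ ^ 2 - a * b * v₃ ^ 2 = -(c * d))
    (huv : a * u₁ * v₁ + b * u₂ * v₂ - a * b * u₃ * v₃ = 0)
    (hVdef : V = a * b * v₂ * x + a * b * v₁ * y - a * b * v₃) (hV : V ≠ 0) :
    ∃ x' y' : L, c * x' ^ 2 + d * y' ^ 2 = 1 ∧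
      x = (c * x' * u₂ - v₂ + y' * (a * (u₃ * v₁ - u₁ * v₃))) /
        (a * (c * x' * u₃ - v₃ - y' * (u₁ * v₂ - u₂ * v₁))) ∧
      y = (c * x' * u₁ - v₁ + y' * (b * (u₂ * v₃ - u₃ * v₂))) /
        (b * (c * x' * u₃ - v₃ - y' * (u₁ * v₂ - u₂ * v₁))) := by
  obtain ⟨U, hU⟩ : ∃ U, U = a * b * u₂ * x + a * b * u₁ * y - a * b * u₃ := ⟨_, rfl⟩
  obtain ⟨W, hW⟩ : ∃ W, W = b * y * (u₂ * v₃ - u₃ * v₂) + a * x * (u₃ * v₁ - u₁ * v₃) +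
    (u₁ * v₂ - u₂ * v₁) := ⟨_, rfl⟩
  have key : c * d * U ^ 2 + (a * b * W) ^ 2 = d * V ^ 2 := by
    rw [hU, hW, hVdef]
    linear_combination (a * b * u₂ * x + a * b * u₁ * y - a * b * u₃) ^ 2 * hv +
      (a * b * v₂ * x + a * b * v₁ * y - a * b * v₃) ^ 2 * hu -
      2 * (a * b * u₂ * x + a * b * u₁ * y - a * b * u₃) *
        (a * b * v₂ * x + a * b * v₁ * y - a * b * v₃) * huv -
      a * b * ((a * u₁ ^ 2 + b * u₂ ^ 2 - a * b * u₃ ^ 2) *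
        (a * v₁ ^ 2 + b * v₂ ^ 2 - a * b * v₃ ^ 2) -
        (a * u₁ * v₁ + b * u₂ * v₂ - a * b * u₃ * v₃) ^ 2) * hxy
  have r₁ : c * (U / V) * u₁ - v₁ + a * b * W / (d * V) * (b * (u₂ * v₃ - u₃ * v₂)) =
      c * d * (b * y) / V := by
    field_simp
    rw [hU, hW, hVdef]
    linear_combination (a * b * u₂ * x + a * b * u₁ * y - a * b * u₃) * u₁ * hv +
      (a * b * v₂ * x + a * b * v₁ * y - a * b * v₃) * v₁ * hu -
      ((a * b * u₂ * x + a * b * u₁ * y - a * b * u₃) * v₁ +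
        (a * b * v₂ * x + a * b * v₁ * y - a * b * v₃) * u₁ -
        (a * u₁ * v₁ + b * u₂ * v₂ - a * b * u₃ * v₃) * (b * y)) * huv -
      b * y * ((a * v₁ ^ 2 + b * v₂ ^ 2 - a * b * v₃ ^ 2) * hu + d * hv)
  have r₂ : c * (U / V) * u₂ - v₂ + a * b * W / (d * V) * (a * (u₃ * v₁ - u₁ * v₃)) =
      c * d * (a * x) / V := by
    field_simp
    rw [hU, hW, hVdef]
    linear_combination (a * b * u₂ * x + a * b * u₁ * y - a * b * u₃) * u₂ * hv +
      (a * b * v₂ * x + a * b * v₁ * y - a * b * v₃) * v₂ * hu -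
      ((a * b * u₂ * x + a * b * u₁ * y - a * b * u₃) * v₂ +
        (a * b * v₂ * x + a * b * v₁ * y - a * b * v₃) * u₂ -
        (a * u₁ * v₁ + b * u₂ * v₂ - a * b * u₃ * v₃) * (a * x)) * huv -
      a * x * ((a * v₁ ^ 2 + b * v₂ ^ 2 - a * b * v₃ ^ 2) * hu + d * hv)
  have r₃ : c * (U / V) * u₃ - v₃ - a * b * W / (d * V) * (u₁ * v₂ - u₂ * v₁) = c * d / V := by
    field_simp
    rw [hU, hW, hVdef]
    linear_combination (a * b * u₂ * x + a * b * u₁ * y - a * b * u₃) * u₃ * hv +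
      (a * b * v₂ * x + a * b * v₁ * y - a * b * v₃) * v₃ * hu -
      ((a * b * u₂ * x + a * b * u₁ * y - a * b * u₃) * v₃ +
        (a * b * v₂ * x + a * b * v₁ * y - a * b * v₃) * u₃ -
        (a * u₁ * v₁ + b * u₂ * v₂ - a * b * u₃ * v₃)) * huv -
      ((a * v₁ ^ 2 + b * v₂ ^ 2 - a * b * v₃ ^ 2) * hu + d * hv)
  refine ⟨U / V, a * b * W / (d * V), ?_, ?_, ?_⟩
  · field_simp
    linear_combination key
  · rw [r₂, r₃]
    field_simp
  · rw [r₁, r₃]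
    field_simp

/-- Orthogonal vectors of values `d`, `-cd` under `⟨a, b, -ab⟩` turn generators for the conic
`(a, b)` into generators for the conic `(c, d)`. -/
theorem IsConicGenerator.exists_of_orthogonal (h2 : (2 : k) ≠ 0) (ha : a ≠ 0) (hb : b ≠ 0)
    {c d : k} (hc : c ≠ 0) (hd : d ≠ 0) {x y : L} (hxy : IsConicGenerator a b x y)
    {u₁ u₂ u₃ v₁ v₂ v₃ : k} (hu : a * u₁ ^ 2 + b * u₂ ^ 2 - a * b * u₃ ^ 2 = d)
    (hv : a * v₁ ^ 2 + b * v₂ ^ 2 - a * b * v₃ ^ 2 = -(c * d))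
    (huv : a * u₁ * v₁ + b * u₂ * v₂ - a * b * u₃ * v₃ = 0) :
    ∃ x' y' : L, IsConicGenerator c d x' y' := by
  have hV : algebraMap k L (a * b * v₂) * x + algebraMap k L (a * b * v₁) * y +
      algebraMap k L (-(a * b * v₃)) ≠ 0 := fun h => by
    obtain ⟨h₁, h₂, h₃⟩ := hxy.eq_zero_of_linear_eq_zero h2 ha hb h
    have e₁ : v₂ = 0 := by simpa [ha, hb] using h₁
    have e₂ : v₁ = 0 := by simpa [ha, hb] using h₂
    have e₃ : v₃ = 0 := by simpa [ha, hb] using h₃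
    simp [e₁, e₂, e₃, hc, hd] at hv
  have huL := congrArg (algebraMap k L) hu
  have hvL := congrArg (algebraMap k L) hv
  have huvL := congrArg (algebraMap k L) huv
  simp only [map_add, map_sub, map_mul, map_neg, map_pow, map_zero, ← sub_eq_add_neg]
    at huL hvL huvL hV
  obtain ⟨x', y', heq, hx, hy⟩ := conic_change_coordinates (by simpa) (by simpa) (by simpa)
    (by simpa) hxy.equation huL hvL huvL rfl hV
  have hmem : ∀ E : IntermediateField k L, x' ∈ E → y' ∈ E → x ∈ E ∧ y ∈ E := by
    intro E hx' hy'
    have hk : ∀ r : k, algebraMap k L r ∈ E := E.algebraMap_mem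
    constructor
    · rw [hx]
      exact div_mem (add_mem (sub_mem (mul_mem (mul_mem (hk _) hx') (hk _)) (hk _)) (mul_mem hy'
        (mul_mem (hk _) (sub_mem (mul_mem (hk _) (hk _)) (mul_mem (hk _) (hk _))))))
        (mul_mem (hk _) (sub_mem (sub_mem (mul_mem (mul_mem (hk _) hx') (hk _)) (hk _))
        (mul_mem hy' (sub_mem (mul_mem (hk _) (hk _)) (mul_mem (hk _) (hk _))))))
    · rw [hy]
      exact div_mem (add_mem (sub_mem (mul_mem (mul_mem (hk _) hx') (hk _)) (hk _)) (mul_mem hy'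
        (mul_mem (hk _) (sub_mem (mul_mem (hk _) (hk _)) (mul_mem (hk _) (hk _))))))
        (mul_mem (hk _) (sub_mem (sub_mem (mul_mem (mul_mem (hk _) hx') (hk _)) (hk _))
        (mul_mem hy' (sub_mem (mul_mem (hk _) (hk _)) (mul_mem (hk _) (hk _))))))
  refine ⟨x', y', heq, fun halg => ?_, ?_⟩
  · have hx' : x' ∈ algebraicClosure k L := mem_algebraicClosure_iff.2 halg
    have hy' : y' ∈ algebraicClosure k L := by
      have hd' : algebraMap k L d ≠ 0 := by simpa
      have hsq : y' ^ 2 ∈ algebraicClosure k L := by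
        rw [show y' ^ 2 = (1 - algebraMap k L c * x' ^ 2) / algebraMap k L d by
          rw [eq_div_iff hd']; linear_combination heq]
        exact div_mem (sub_mem (one_mem _) (mul_mem (IntermediateField.algebraMap_mem _ _)
          (pow_mem hx' 2))) (IntermediateField.algebraMap_mem _ _)
      rw [mem_algebraicClosure_iff] at hsq ⊢
      exact hsq.of_pow two_pos
    exact hxy.transcendental (mem_algebraicClosure_iff.1 (hmem _ hx' hy').1)
  · obtain ⟨h₁, h₂⟩ := hmem (IntermediateField.adjoin k {x', y'})
      (IntermediateField.subset_adjoin _ _ (by simp)) (IntermediateField.subset_adjoin _ _ (by simp))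
    rw [eq_top_iff, ← hxy.adjoin_eq_top, IntermediateField.adjoin_le_iff]
    rintro z (rfl | rfl)
    exacts [h₁, h₂]

end ConicGenerator

section OrthogonalPair

variable {k : Type*} [Field k] {a b c d : k}

theorem exists_fraction_pureForm_eq {F : Type*} [Field F] {a b D X₀ X₁ Y₀ Y₁ : F}
    (H : PureAnisotropic a b)
    (h₀ : a * X₀ ^ 2 + b * Y₀ ^ 2 - 1 + D * (a * X₁ ^ 2 + b * Y₁ ^ 2) = 0)
    (h₁ : a * X₀ * X₁ + b * Y₀ * Y₁ = 0) :
    ∃ f g h : F, a * f ^ 2 + b * g ^ 2 - a * b * h ^ 2 = D := by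
  have hN : a * X₁ ^ 2 + b * Y₁ ^ 2 ≠ 0 := by
    intro hN
    obtain ⟨-, -, h⟩ := H (b * Y₀) (a * X₀) 1 (by linear_combination a * b * h₀ - a * b * D * hN)
    exact one_ne_zero h
  refine ⟨X₁ / (a * X₁ ^ 2 + b * Y₁ ^ 2), Y₁ / (a * X₁ ^ 2 + b * Y₁ ^ 2),
    (X₀ * Y₁ - Y₀ * X₁) / (a * X₁ ^ 2 + b * Y₁ ^ 2), ?_⟩
  field_simp
  linear_combination (a * X₀ * X₁ + b * Y₀ * Y₁) * h₁ - (a * X₁ ^ 2 + b * Y₁ ^ 2) * h₀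

theorem exists_orthogonal_of_conicQuadraticModel_point (h2 : (2 : k) ≠ 0) (hc : c ≠ 0)
    (hd : d ≠ 0) (H : PureAnisotropic a b)
    [Fact (Irreducible (X ^ 2 - C (conicRadicand c d)))] {x y : ConicQuadraticModel c d}
    (hxy : algebraMap k (ConicQuadraticModel c d) a * x ^ 2 +
      algebraMap k (ConicQuadraticModel c d) b * y ^ 2 = 1) :
    ∃ u₁ u₂ u₃ v₁ v₂ v₃ : k, a * u₁ ^ 2 + b * u₂ ^ 2 - a * b * u₃ ^ 2 = d ∧
      a * v₁ ^ 2 + b * v₂ ^ 2 - a * b * v₃ ^ 2 = -(c * d) ∧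
      a * u₁ * v₁ + b * u₂ * v₂ - a * b * u₃ * v₃ = 0 := by
  obtain ⟨X₀, X₁, rfl⟩ := ConicQuadraticModel.exists_eq_add_mul_y c d x
  obtain ⟨Y₀, Y₁, rfl⟩ := ConicQuadraticModel.exists_eq_add_mul_y c d y
  rw [IsScalarTower.algebraMap_apply k (FractionRing k[X]) (ConicQuadraticModel c d),
    IsScalarTower.algebraMap_apply k (FractionRing k[X]) (ConicQuadraticModel c d),
    IsScalarTower.algebraMap_apply k k[X] (FractionRing k[X]),
    IsScalarTower.algebraMap_apply k k[X] (FractionRing k[X]), algebraMap_eq] at hxy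
  have hsplit := ConicQuadraticModel.eq_zero_of_add_mul_y_eq_zero h2 hc hd
    (s := algebraMap k[X] (FractionRing k[X]) (C a) * X₀ ^ 2 +
      algebraMap k[X] (FractionRing k[X]) (C b) * Y₀ ^ 2 - 1 +
      conicRadicand c d * (algebraMap k[X] (FractionRing k[X]) (C a) * X₁ ^ 2 +
      algebraMap k[X] (FractionRing k[X]) (C b) * Y₁ ^ 2))
    (t := 2 * (algebraMap k[X] (FractionRing k[X]) (C a) * X₀ * X₁ +
      algebraMap k[X] (FractionRing k[X]) (C b) * Y₀ * Y₁)) (by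
    simp only [map_add, map_sub, map_mul, map_pow, map_one, map_ofNat,
      ← ConicQuadraticModel.y_sq]
    linear_combination hxy)
  have h2F : (2 : FractionRing k[X]) ≠ 0 := by
    rw [← map_ofNat (algebraMap k (FractionRing k[X])) 2]
    exact (_root_.map_ne_zero _).2 h2
  obtain ⟨f, g, h, hD⟩ := exists_fraction_pureForm_eq H.polynomial.fractionRing hsplit.1
    ((mul_eq_zero.1 hsplit.2).resolve_left h2F)
  obtain ⟨s, f', g', h', hs, hf, hg, hh⟩ := exists_common_denominator_three (R := k[X]) f g h
  obtain ⟨p₁, p₂, p₃, hp⟩ := exists_polynomial_of_pureForm_eq_sq_mul H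
    (C d⁻¹ * (1 - C c * X ^ 2)) _ s f' g' h' hs le_rfl (by
      apply IsFractionRing.injective k[X] (FractionRing k[X])
      rw [map_mul _ (s ^ 2), ← conicRadicand, ← hD]
      simp only [map_add, map_sub, map_mul, map_pow, hf, hg, hh]
      ring)
  obtain ⟨n₁, n₂, n₃⟩ := natDegree_le_of_pureForm (m := 1) H (by rw [hp]; compute_degree)
  obtain ⟨v₁, u₁, rfl⟩ := exists_eq_X_add_C_of_natDegree_le_one n₁
  obtain ⟨v₂, u₂, rfl⟩ := exists_eq_X_add_C_of_natDegree_le_one n₂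
  obtain ⟨v₃, u₃, rfl⟩ := exists_eq_X_add_C_of_natDegree_le_one n₃
  obtain ⟨e₂, e₁, e₀⟩ := eq_zero_of_quadratic_eq_zero
    (r := a * v₁ ^ 2 + b * v₂ ^ 2 - a * b * v₃ ^ 2 + d⁻¹ * c)
    (s := 2 * (a * u₁ * v₁ + b * u₂ * v₂ - a * b * u₃ * v₃))
    (t := a * u₁ ^ 2 + b * u₂ ^ 2 - a * b * u₃ ^ 2 - d⁻¹) (by
      simp only [map_add, map_mul, map_sub, map_pow, C_ofNat]
      linear_combination hp)
  have hdd : d * d⁻¹ = 1 := mul_inv_cancel₀ hd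
  refine ⟨d * u₁, d * u₂, d * u₃, d * v₁, d * v₂, d * v₃, ?_, ?_, ?_⟩
  · linear_combination d ^ 2 * e₀ + d * hdd
  · linear_combination d ^ 2 * e₂ - c * d * hdd
  · linear_combination d ^ 2 * (mul_eq_zero.1 e₁).resolve_left h2

end OrthogonalPair

theorem stmt_4 (k : Type u) [Field k] (h2 : (2 : k) ≠ 0) (a b c d : k)
    (ha : a ≠ 0) (hb : b ≠ 0) (hc : c ≠ 0) (hd : d ≠ 0)
    (hdiv : ∀ x : ℍ[k,a,b], x ≠ 0 → IsUnit x)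
    (hhom : Nonempty (conicFunctionField k a b →ₐ[k] conicFunctionField k c d)) :
    Nonempty (conicFunctionField k a b ≃ₐ[k] conicFunctionField k c d) := by
  have : Fact (Irreducible (X ^ 2 - C (conicRadicand a b))) :=
    ⟨irreducible_X_sq_sub_conicRadicand h2 ha hb⟩
  have : Fact (Irreducible (X ^ 2 - C (conicRadicand c d))) :=
    ⟨irreducible_X_sq_sub_conicRadicand h2 hc hd⟩
  have hab := ConicQuadraticModel.isConicGenerator (a := a) hb
  obtain ⟨e⟩ := hab.nonempty_algEquiv h2 ha hb
  obtain ⟨e'⟩ := (ConicQuadraticModel.isConicGenerator (a := c) hd).nonempty_algEquiv h2 hc hd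
  obtain ⟨φ⟩ := hhom
  let ψ : ConicQuadraticModel a b →ₐ[k] ConicQuadraticModel c d :=
    (e'.toAlgHom.comp φ).comp e.symm.toAlgHom
  have hpoint := congrArg ψ hab.equation
  rw [map_add, map_mul, map_mul, map_pow, map_pow, map_one, ψ.commutes, ψ.commutes] at hpoint
  obtain ⟨u₁, u₂, u₃, v₁, v₂, v₃, hu, hv, huv⟩ :=
    exists_orthogonal_of_conicQuadraticModel_point h2 hc hd
      (pureAnisotropic_of_division hdiv) hpoint
  obtain ⟨x', y', hxy'⟩ := hab.exists_of_orthogonal h2 ha hb hc hd hu hv huv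
  obtain ⟨e''⟩ := hxy'.nonempty_algEquiv h2 hc hd
  exact ⟨e.trans e''.symm⟩

end
end
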